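/- arXiv:2001.01183 — 3 statements merged into one kernel-verified Lean document; each statement's English description precedes it below -/
import Mathlib

section
/- Let G be a group acting distally and minimally by homeomorphisms on a compact metric space X which is not a single point. Then the action has a nontrivial equicontinuous factor: there exist a compact metric space Y containing more than one point, an equicontinuous minimal action of G on Y by homeomorphisms, and a continuous G-equivariant surjection f : X → Y. -/
namespace DistalFactor

open Set Filter Topology

section
variable {G : Type*} [Group G] {X : Type*} [MetricSpace X]

theorem mul_app (φ : G →* (X ≃ₜ X)) (g h : G) (x : X) : φ (g * h) x = φ g (φ h x) := by
  rw [map_mul]; rfl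

theorem one_app (φ : G →* (X ≃ₜ X)) (x : X) : φ 1 x = x := by
  rw [map_one]; rfl

theorem inv_app (φ : G →* (X ≃ₜ X)) (g : G) (x : X) : φ g⁻¹ (φ g x) = x := by
  rw [← mul_app, inv_mul_cancel, one_app]

def ellis (φ : G →* (X ≃ₜ X)) : Set (X → X) := closure (range fun g : G => (φ g : X → X))

def Inv (φ : G →* (X ≃ₜ X)) (A : Set (X × X)) : Prop :=
  ∀ g x y, (x, y) ∈ A → (φ g x, φ g y) ∈ A

def near (φ : G →* (X ≃ₜ X)) (ε : ℝ) : Set (X × X) :=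
  {p | ∃ g, dist (φ g p.1) (φ g p.2) < ε}

theorem near_open (φ : G →* (X ≃ₜ X)) (ε : ℝ) : IsOpen (near φ ε) := by
  have : near φ ε = ⋃ g, {p : X × X | dist (φ g p.1) (φ g p.2) < ε} := by
    ext p; simp [near]
  rw [this]
  refine isOpen_iUnion fun g => isOpen_lt ?_ continuous_const
  exact ((φ g).continuous.comp continuous_fst).dist ((φ g).continuous.comp continuous_snd)

theorem near_inv (φ : G →* (X ≃ₜ X)) (ε : ℝ) : Inv φ (near φ ε) := by
  rintro g x y ⟨h, hh⟩
  refine ⟨h * g⁻¹, ?_⟩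
  simpa [mul_app, inv_app] using hh

theorem near_symm (φ : G →* (X ≃ₜ X)) {ε : ℝ} {x y : X} (h : (x, y) ∈ near φ ε) :
    (y, x) ∈ near φ ε := by
  obtain ⟨g, hg⟩ := h
  exact ⟨g, by simpa [dist_comm] using hg⟩

theorem near_mono (φ : G →* (X ≃ₜ X)) {ε δ : ℝ} (h : ε ≤ δ) : near φ ε ⊆ near φ δ :=
  fun _ ⟨g, hg⟩ => ⟨g, hg.trans_le h⟩

theorem inv_closure {φ : G →* (X ≃ₜ X)} {A : Set (X × X)} (hA : Inv φ A) :
    Inv φ (closure A) := by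
  intro g x y h
  have hc : Continuous fun p : X × X => (φ g p.1, φ g p.2) :=
    ((φ g).continuous.comp continuous_fst).prodMk ((φ g).continuous.comp continuous_snd)
  have hm : MapsTo (fun p : X × X => (φ g p.1, φ g p.2)) A A := fun p hp => hA g p.1 p.2 hp
  exact hm.closure hc h

theorem inv_compl {φ : G →* (X ≃ₜ X)} {A : Set (X × X)} (hA : Inv φ A) : Inv φ Aᶜ := by
  intro g x y h h'
  have := hA g⁻¹ _ _ h'
  rw [inv_app, inv_app] at this
  exact h this

theorem ellis_pres {φ : G →* (X ≃ₜ X)} {A : Set (X × X)} (hA : Inv φ A) (hc : IsClosed A)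
    {p : X → X} (hp : p ∈ ellis φ) {x y : X} (h : (x, y) ∈ A) : (p x, p y) ∈ A := by
  have hcl : IsClosed {p : X → X | (p x, p y) ∈ A} :=
    hc.preimage ((continuous_apply x).prodMk (continuous_apply y))
  refine closure_minimal ?_ hcl hp
  rintro _ ⟨g, rfl⟩
  exact hA g x y h

theorem ellis_comp {φ : G →* (X ≃ₜ X)} {p q : X → X} (hp : p ∈ ellis φ) (hq : q ∈ ellis φ) :
    p ∘ q ∈ ellis φ := by
  have h1 : ∀ g, (φ g : X → X) ∘ q ∈ ellis φ := by
    intro g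
    have hc : Continuous fun r : X → X => (φ g : X → X) ∘ r :=
      continuous_pi fun x => (φ g).continuous.comp (continuous_apply x)
    refine map_mem_closure hc hq ?_
    rintro _ ⟨h, rfl⟩
    exact ⟨g * h, by ext x; exact mul_app φ g h x⟩
  have hc : Continuous fun r : X → X => r ∘ q := continuous_pi fun x => continuous_apply (q x)
  have hcl : IsClosed {r : X → X | r ∘ q ∈ ellis φ} := isClosed_closure.preimage hc
  refine closure_minimal ?_ hcl hp
  rintro _ ⟨g, rfl⟩
  exact h1 g

theorem ellis_nonempty (φ : G →* (X ≃ₜ X)) : (ellis φ).Nonempty :=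
  ⟨φ 1, subset_closure ⟨1, rfl⟩⟩

variable [CompactSpace X]

theorem ellis_compact (φ : G →* (X ≃ₜ X)) : IsCompact (ellis φ) := isClosed_closure.isCompact

theorem not_near {φ : G →* (X ≃ₜ X)}
    (hd : ∀ x x' : X, x ≠ x' → 0 < ⨅ g : G, dist (φ g x) (φ g x')) {x y : X}
    (h : ∀ ε > 0, (x, y) ∈ near φ ε) : x = y := by
  by_contra hne
  obtain ⟨g, hg⟩ := h _ (hd x y hne)
  refine absurd hg (not_lt.2 (ciInf_le ?_ g))
  exact ⟨0, by rintro _ ⟨g, rfl⟩; exact dist_nonneg⟩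

theorem ellis_near {φ : G →* (X ≃ₜ X)} {p : X → X} (hp : p ∈ ellis φ) {x y : X} (h : p x = p y)
    {ε : ℝ} (hε : 0 < ε) : (x, y) ∈ near φ ε := by
  have ho : IsOpen {r : X → X | dist (r x) (r y) < ε} :=
    isOpen_lt ((continuous_apply x).dist (continuous_apply y)) continuous_const
  obtain ⟨_, hr, g, rfl⟩ := mem_closure_iff.1 hp _ ho (by simpa [h] using hε)
  exact ⟨g, hr⟩

theorem ellis_linv {φ : G →* (X ≃ₜ X)}
    (hd : ∀ x x' : X, x ≠ x' → 0 < ⨅ g : G, dist (φ g x) (φ g x'))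
    {p : X → X} (hp : p ∈ ellis φ) : ∃ q ∈ ellis φ, ∀ x, q (p x) = x := by
  have hc : ∀ r : X → X, Continuous fun q : X → X => q ∘ r := 
    fun r => continuous_pi fun x => continuous_apply (r x)
  let inst : Semigroup (X → X) :=
    { mul := fun a b => a ∘ b, mul_assoc := fun _ _ _ => rfl }
  obtain ⟨u, ⟨q, hq, rfl⟩, huu⟩ := 
    @exists_idempotent_in_compact_subsemigroup (X → X) inst _ _ hc ((fun q => q ∘ p) '' ellis φ)
      ((ellis_nonempty φ).image _) ((ellis_compact φ).image (hc p)) (by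
        rintro _ ⟨a, ha, rfl⟩ _ ⟨b, hb, rfl⟩
        exact ⟨a ∘ p ∘ b, ellis_comp ha (ellis_comp hp hb), rfl⟩)
  refine ⟨q, hq, fun x => ?_⟩
  have h1 : q (p (q (p x))) = q (p x) := congrFun huu x
  exact not_near hd fun ε hε => ellis_near (ellis_comp hq hp) (x := q (p x)) (y := x) h1 hε

theorem ellis_inv {φ : G →* (X ≃ₜ X)}
    (hd : ∀ x x' : X, x ≠ x' → 0 < ⨅ g : G, dist (φ g x) (φ g x'))
    {p : X → X} (hp : p ∈ ellis φ) :
    ∃ q ∈ ellis φ, (∀ x, q (p x) = x) ∧ ∀ x, p (q x) = x := by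
  obtain ⟨q, hq, h⟩ := ellis_linv hd hp
  obtain ⟨r, hr, h'⟩ := ellis_linv hd hq
  refine ⟨q, hq, h, fun x => ?_⟩
  have : r x = p x := by rw [← h' (p x), h]
  rw [← h' (p (q x)), h, h']

theorem ellis_trans {φ : G →* (X ≃ₜ X)}
    (hmin : ∀ x : X, Dense (range fun g : G => φ g x)) (x y : X) : ∃ p ∈ ellis φ, p x = y := by
  have hcl : IsClosed ((fun p : X → X => p x) '' ellis φ) :=
    ((ellis_compact φ).image (continuous_apply x)).isClosed
  refine closure_minimal ?_ hcl (hmin x y)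
  rintro _ ⟨g, rfl⟩
  exact ⟨φ g, subset_closure ⟨g, rfl⟩, rfl⟩

theorem open_proj {φ : G →* (X ≃ₜ X)}
    (hd : ∀ x x' : X, x ≠ x' → 0 < ⨅ g : G, dist (φ g x) (φ g x'))
    (hmin : ∀ x : X, Dense (range fun g : G => φ g x))
    {A : Set (X × X)} (hA : Inv φ A) (hc : IsClosed A) {x y : X} (hxy : (x, y) ∈ A)
    {V : Set X} (hV : IsOpen V) (hy : y ∈ V) : ∀ᶠ x' in 𝓝 x, ∃ y' ∈ V, (x', y') ∈ A := by
  by_contra hcon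
  set D : Set X := {x' | ¬ ∃ y' ∈ V, (x', y') ∈ A} with hD
  have hxD : x ∈ closure D := mem_closure_iff_frequently.2 (not_eventually.1 hcon)
  set T : Set (X → X) := {p | p ∈ ellis φ ∧ p x ∈ D} with hT
  have hTE : closure T ⊆ ellis φ := closure_minimal (fun p hp => hp.1) isClosed_closure
  have hcl : IsClosed ((fun p : X → X => p x) '' closure T) :=
    (isClosed_closure.isCompact.image (continuous_apply x)).isClosed
  obtain ⟨p, hpT, hpx⟩ : x ∈ (fun p : X → X => p x) '' closure T := by
    refine closure_minimal ?_ hcl hxD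
    intro x' hx'
    obtain ⟨p, hp, rfl⟩ := ellis_trans hmin x x'
    exact ⟨p, subset_closure ⟨hp, hx'⟩, rfl⟩
  obtain ⟨q, hq, hqp, hpq⟩ := ellis_inv hd (hTE hpT)
  have hqx : q x = x := by
    have := hqp x
    rwa [show p x = x from hpx] at this
  obtain ⟨p', hp'V, hp'E, hp'D⟩ := mem_closure_iff.1 hpT {r : X → X | r (q y) ∈ V}
    (hV.preimage (continuous_apply (q y))) (by simpa [hpq] using hy)
  have := ellis_pres hA hc hp'E (ellis_pres hA hc hq hxy)
  rw [hqx] at this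
  exact hp'D ⟨_, hp'V, this⟩

theorem furst {φ : G →* (X ≃ₜ X)}
    (hd : ∀ x x' : X, x ≠ x' → 0 < ⨅ g : G, dist (φ g x) (φ g x'))
    {ε : ℝ} {x y : X} (hxy : (x, y) ∈ near φ ε) :
    ∃ δ > 0, ∀ z, (x, z) ∈ near φ δ → (z, y) ∈ near φ ε := by
  by_contra hcon
  push Not at hcon
  choose z hz hz' using fun n : ℕ => hcon (1 / ((n : ℝ) + 1)) Nat.one_div_pos_of_nat
  choose h hh using hz
  obtain ⟨⟨a, b⟩, -, s, hs, hlim⟩ := (isCompact_univ (X := X × X)).tendsto_subseq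
    (x := fun n => (φ (h n) x, φ (h n) y)) (fun n => mem_univ _)
  have hmem : (a, b) ∈ (fun p : X → X => (p x, p y)) '' ellis φ := by
    have hcl : IsClosed ((fun p : X → X => (p x, p y)) '' ellis φ) :=
      ((ellis_compact φ).image ((continuous_apply x).prodMk (continuous_apply y))).isClosed
    exact hcl.mem_of_tendsto hlim (Eventually.of_forall fun n =>
      ⟨φ (h (s n)), subset_closure ⟨_, rfl⟩, rfl⟩)
  obtain ⟨p, hp, hpab⟩ := hmem
  simp only [Prod.mk.injEq] at hpab
  obtain ⟨q, hq, hqp, -⟩ := ellis_inv hd hp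
  have hab : (a, b) ∈ near φ ε := by
    by_contra hn
    have := ellis_pres (inv_compl (near_inv φ ε)) (near_open φ ε).isClosed_compl hq hn
    rw [← hpab.1, ← hpab.2, hqp, hqp] at this
    exact this hxy
  have ha : Tendsto (fun n => φ (h (s n)) x) atTop (𝓝 a) :=
    (continuous_fst.tendsto (a, b)).comp hlim
  have hb : Tendsto (fun n => φ (h (s n)) y) atTop (𝓝 b) :=
    (continuous_snd.tendsto (a, b)).comp hlim
  have hza : Tendsto (fun n => φ (h (s n)) (z (s n))) atTop (𝓝 a) := by
    refine (tendsto_iff_of_dist ?_).1 ha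
    have h0 := (tendsto_one_div_add_atTop_nhds_zero_nat (𝕜 := ℝ)).comp hs.tendsto_atTop
    exact squeeze_zero (fun _ => dist_nonneg) (fun n => (hh (s n)).le) h0
  have hev := (hza.prodMk_nhds hb).eventually ((near_open φ ε).mem_nhds hab)
  obtain ⟨n, hn⟩ := hev.exists
  have := near_inv φ ε (h (s n))⁻¹ _ _ hn
  rw [inv_app, inv_app] at this
  exact hz' (s n) this

def rp (φ : G →* (X ≃ₜ X)) : Set (X × X) := ⋂ δ : {δ : ℝ // 0 < δ}, closure (near φ δ)

theorem rp_closed (φ : G →* (X ≃ₜ X)) : IsClosed (rp φ) :=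
  isClosed_iInter fun _ => isClosed_closure

theorem rp_inv (φ : G →* (X ≃ₜ X)) : Inv φ (rp φ) := by
  intro g x y h
  refine mem_iInter.2 fun δ => ?_
  exact inv_closure (near_inv φ δ) g x y (mem_iInter.1 h δ)

theorem closure_near_symm (φ : G →* (X ≃ₜ X)) {ε : ℝ} {x y : X} (h : (x, y) ∈ closure (near φ ε)) :
    (y, x) ∈ closure (near φ ε) := by
  have hm : MapsTo (Prod.swap : X × X → X × X) (near φ ε) (near φ ε) :=
    fun p hp => near_symm φ (x := p.1) (y := p.2) hp
  exact hm.closure continuous_swap h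

theorem rp_symm (φ : G →* (X ≃ₜ X)) {x y : X} (h : (x, y) ∈ rp φ) : (y, x) ∈ rp φ :=
  mem_iInter.2 fun δ => closure_near_symm φ (mem_iInter.1 h δ)

theorem step1 {φ : G →* (X ≃ₜ X)}
    (hd : ∀ x x' : X, x ≠ x' → 0 < ⨅ g : G, dist (φ g x) (φ g x'))
    (hmin : ∀ x : X, Dense (range fun g : G => φ g x)) {ε : ℝ} {x y z : X}
    (hxy : (x, y) ∈ near φ ε) (hxz : (x, z) ∈ rp φ) : (z, y) ∈ closure (near φ ε) := by
  by_contra hn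
  obtain ⟨Vz, Vy, hVz, hVy, hz, hy, hsub⟩ := isOpen_prod_iff.1
    (isClosed_closure (s := near φ ε)).isOpen_compl z y hn
  obtain ⟨δ, hδ, hB⟩ := furst hd hxy
  set B : Set (X × X) := {p | ∀ z, (p.1, z) ∈ near φ δ → (z, p.2) ∈ closure (near φ ε)} with hBdef
  have hBc : IsClosed B := by
    have : B = ⋂ z, ({p : X × X | (p.1, z) ∈ (near φ δ)ᶜ} ∪
        {p : X × X | (z, p.2) ∈ closure (near φ ε)}) := by
      ext p
      simp only [hBdef, mem_ofPred_eq, mem_iInter, mem_union, mem_compl_iff, imp_iff_not_or]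
    rw [this]
    refine isClosed_iInter fun z => IsClosed.union ?_ ?_
    · exact (near_open φ δ).isClosed_compl.preimage (continuous_fst.prodMk continuous_const)
    · exact isClosed_closure.preimage (continuous_const.prodMk continuous_snd)
  have hBi : Inv φ B := by
    intro g x y h z hz
    have h1 := near_inv φ δ g⁻¹ _ _ hz
    simp only [inv_app] at h1
    have h2 := inv_closure (near_inv φ ε) g _ _ (h _ h1)
    have h3 := inv_app φ g⁻¹ z
    rw [inv_inv] at h3
    rwa [h3] at h2
  have hxB : (x, y) ∈ B := fun z hz => subset_closure (hB z hz)
  obtain ⟨Vx, hVx, hVxo, hx⟩ := eventually_nhds_iff.1 (open_proj hd hmin hBi hBc hxB hVy hy)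
  obtain ⟨⟨x', z'⟩, ⟨hx', hz'⟩, hnear⟩ := mem_closure_iff.1 (mem_iInter.1 hxz ⟨δ, hδ⟩)
    (Vx ×ˢ Vz) (hVxo.prod hVz) ⟨hx, hz⟩
  obtain ⟨y', hy', hB'⟩ := hVx x' hx'
  exact hsub (show (z', y') ∈ Vz ×ˢ Vy from ⟨hz', hy'⟩) (hB' z' hnear)

theorem step2 {φ : G →* (X ≃ₜ X)}
    (hd : ∀ x x' : X, x ≠ x' → 0 < ⨅ g : G, dist (φ g x) (φ g x'))
    (hmin : ∀ x : X, Dense (range fun g : G => φ g x)) {ε : ℝ} {x y z : X}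
    (hxy : (x, y) ∈ closure (near φ ε)) (hxz : (x, z) ∈ rp φ) :
    (z, y) ∈ closure (near φ ε) := by
  by_contra hn
  obtain ⟨Vz, Vy, hVz, hVy, hz, hy, hsub⟩ := isOpen_prod_iff.1
    (isClosed_closure (s := near φ ε)).isOpen_compl z y hn
  obtain ⟨Vx, hVx, hVxo, hx⟩ := eventually_nhds_iff.1
    (open_proj hd hmin (rp_inv φ) (rp_closed φ) hxz hVz hz)
  obtain ⟨⟨x', y'⟩, ⟨hx', hy'⟩, hnear⟩ := mem_closure_iff.1 hxy
    (Vx ×ˢ Vy) (hVxo.prod hVy) ⟨hx, hy⟩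
  obtain ⟨z', hz', hQ⟩ := hVx x' hx'
  exact hsub (show (z', y') ∈ Vz ×ˢ Vy from ⟨hz', hy'⟩) (step1 hd hmin hnear hQ)

theorem exists_eps {φ : G →* (X ≃ₜ X)}
    (hd : ∀ x x' : X, x ≠ x' → 0 < ⨅ g : G, dist (φ g x) (φ g x'))
    (hX : ∃ x x' : X, x ≠ x') : ∃ ε > 0, ¬ Dense (near φ ε) := by
  by_contra hcon
  push Not at hcon
  have hdense : Dense (⋂ n : ℕ, near φ (1 / ((n : ℝ) + 1))) :=
    dense_iInter_of_isOpen_nat (fun n => near_open φ _) (fun n => hcon _ Nat.one_div_pos_of_nat)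
  have hsub : (⋂ n : ℕ, near φ (1 / ((n : ℝ) + 1))) ⊆ diagonal X := by
    rintro ⟨x, y⟩ h
    refine not_near hd fun ε hε => ?_
    obtain ⟨n, hn⟩ := exists_nat_one_div_lt hε
    exact near_mono φ hn.le (mem_iInter.1 h n)
  obtain ⟨x, x', hne⟩ := hX
  exact hne (closure_minimal hsub isClosed_diagonal (hdense (x, x')))

theorem exists_fun {φ : G →* (X ≃ₜ X)}
    (hd : ∀ x x' : X, x ≠ x' → 0 < ⨅ g : G, dist (φ g x) (φ g x'))
    (hmin : ∀ x : X, Dense (range fun g : G => φ g x))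
    (hX : ∃ x x' : X, x ≠ x') :
    ∃ u : X → ℝ, Continuous u ∧ (∃ x x', u x ≠ u x') ∧
      ∀ x x', (x, x') ∈ rp φ → u x = u x' := by
  obtain ⟨ε, hε, hnd⟩ := exists_eps hd hX
  obtain ⟨⟨x0, y0⟩, hxy⟩ : ∃ p, p ∉ closure (near φ ε) := by
    by_contra hcon
    push Not at hcon
    exact hnd hcon
  set N : X → Set X := fun x => {y | (x, y) ∈ closure (near φ ε)} with hN
  have hself : ∀ x, x ∈ N x := fun x => subset_closure ⟨1, by simpa using hε⟩
  have hNc : ∀ x, IsClosed (N x) := fun x =>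
    isClosed_closure.preimage (continuous_const.prodMk continuous_id)
  have hlt : ∀ x c, Metric.infDist y0 (N x) < c ↔ ∃ y ∈ N x, dist y0 y < c := fun x c =>
    Metric.infDist_lt_iff ⟨x, hself x⟩
  refine ⟨fun x => Metric.infDist y0 (N x), ?_, ⟨x0, y0, ?_⟩, ?_⟩
  · refine continuous_iff_continuousAt.2 fun x => tendsto_order.2 ⟨fun c hc => ?_, fun c hc => ?_⟩
    · obtain ⟨c', hc', hc''⟩ := exists_between hc
      have hK : IsCompact (closure (near φ ε) ∩ {p : X × X | dist y0 p.2 ≤ c'}) :=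
        (isClosed_closure.inter
          (isClosed_le (continuous_const.dist continuous_snd) continuous_const)).isCompact
      have hcl := (hK.image continuous_fst).isClosed
      have hx : x ∈ (Prod.fst '' (closure (near φ ε) ∩ {p : X × X | dist y0 p.2 ≤ c'}))ᶜ := by
        rintro ⟨⟨x1, y⟩, ⟨h1, h2⟩, rfl⟩
        exact absurd (Metric.infDist_le_dist_of_mem (x := y0) (s := N x1) h1)
          (not_le.2 (lt_of_le_of_lt h2 hc''))
      filter_upwards [hcl.isOpen_compl.mem_nhds hx] with x' hx'
      refine hc'.trans_le (not_lt.1 fun hlt' => ?_)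
      obtain ⟨y, hy, hy'⟩ := (hlt x' c').1 hlt'
      exact hx' ⟨(x', y), ⟨hy, le_of_lt hy'⟩, rfl⟩
    · obtain ⟨y, hy, hy'⟩ := (hlt x c).1 hc
      have := open_proj hd hmin (inv_closure (near_inv φ ε)) isClosed_closure
        (x := x) (y := y) hy (V := {y | dist y0 y < c})
        (isOpen_lt (continuous_const.dist continuous_id) continuous_const) hy'
      filter_upwards [this] with x' hx'
      obtain ⟨y', h1, h2⟩ := hx'
      exact (hlt x' c).2 ⟨y', h2, h1⟩
  · have h1 : Metric.infDist y0 (N y0) = 0 := Metric.infDist_zero_of_mem (hself y0)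
    have h2 : 0 < Metric.infDist y0 (N x0) :=
      ((hNc x0).notMem_iff_infDist_pos ⟨x0, hself x0⟩).1 hxy
    simp only [h1]
    exact h2.ne'
  · intro x x' h
    have : N x = N x' := by
      ext y
      exact ⟨fun hy => step2 hd hmin hy h, fun hy => step2 hd hmin hy (rp_symm φ h)⟩
    simp only [this]

theorem unif {φ : G →* (X ≃ₜ X)} {u : X → ℝ} (hu : Continuous u)
    (hq : ∀ x x', (x, x') ∈ rp φ → u x = u x') {η : ℝ} (hη : 0 < η) :
    ∃ δ > 0, ∀ x x', (x, x') ∈ near φ δ → dist (u x) (u x') < η := by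
  by_contra hcon
  push Not at hcon
  choose x x' hn hd using fun n : ℕ => hcon (1 / ((n : ℝ) + 1)) Nat.one_div_pos_of_nat
  obtain ⟨⟨a, b⟩, -, s, hs, hlim⟩ := (isCompact_univ (X := X × X)).tendsto_subseq
    (x := fun n => (x n, x' n)) (fun n => mem_univ _)
  have hab : (a, b) ∈ rp φ := by
    refine mem_iInter.2 fun ⟨δ, hδ⟩ => ?_
    refine mem_closure_of_tendsto hlim ?_
    have h0 := (tendsto_one_div_add_atTop_nhds_zero_nat (𝕜 := ℝ)).comp hs.tendsto_atTop
    filter_upwards [h0.eventually (gt_mem_nhds hδ)] with n hn'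
    exact near_mono φ (le_of_lt hn') (hn (s n))
  have hc : Continuous fun p : X × X => dist (u p.1) (u p.2) :=
    (hu.comp continuous_fst).dist (hu.comp continuous_snd)
  have h1 : η ≤ dist (u a) (u b) :=
    ge_of_tendsto ((hc.tendsto (a, b)).comp hlim) (Eventually.of_forall fun n => hd (s n))
  rw [hq a b hab, dist_self] at h1
  exact absurd h1 (not_le.2 hη)

theorem exists_map {φ : G →* (X ≃ₜ X)}
    (hd : ∀ x x' : X, x ≠ x' → 0 < ⨅ g : G, dist (φ g x) (φ g x'))
    (hmin : ∀ x : X, Dense (range fun g : G => φ g x))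
    (hX : ∃ x x' : X, x ≠ x') :
    ∃ (Z : Type) (_ : MetricSpace Z) (f : X → Z), Continuous f ∧ (∃ x x', f x ≠ f x') ∧
      ∀ g x x', dist (f (φ g x)) (f (φ g x')) = dist (f x) (f x') := by
  obtain ⟨u, hu, ⟨x0, x1, hne⟩, hq⟩ := exists_fun hd hmin hX
  letI : TopologicalSpace G := ⊥
  haveI : DiscreteTopology G := ⟨rfl⟩
  obtain ⟨C, hC⟩ := (isCompact_range hu).isBounded.exists_norm_le
  let e : X → BoundedContinuousFunction G ℝ := fun x =>
    BoundedContinuousFunction.ofNormedAddCommGroupDiscrete (fun g => u (φ g x)) C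
      (fun g => hC _ ⟨_, rfl⟩)
  have he : ∀ x g, e x g = u (φ g x) := fun x g => rfl
  have hle : ∀ g x x', dist (e (φ g x)) (e (φ g x')) ≤ dist (e x) (e x') := by
    intro g x x'
    refine (BoundedContinuousFunction.dist_le dist_nonneg).2 fun h => ?_
    rw [he, he, ← mul_app, ← mul_app, ← he, ← he]
    exact BoundedContinuousFunction.dist_coe_le_dist _
  have hiso : ∀ g x x', dist (e (φ g x)) (e (φ g x')) = dist (e x) (e x') := by
    intro g x x'
    refine le_antisymm (hle g x x') ?_
    have := hle g⁻¹ (φ g x) (φ g x')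
    rwa [inv_app, inv_app] at this
  have hec : Continuous e := by
    refine Metric.continuous_iff.2 fun x η hη => ?_
    obtain ⟨δ, hδ, h⟩ := unif hu hq (half_pos hη)
    refine ⟨δ, hδ, fun x' hx' => lt_of_le_of_lt ?_ (half_lt_self hη)⟩
    refine (BoundedContinuousFunction.dist_le (half_pos hη).le).2 fun g => ?_
    rw [he, he]
    exact (h _ _ (near_inv φ δ g _ _ ⟨1, by simpa [one_app] using hx'⟩)).le
  haveI : CompactSpace (range e) := isCompact_iff_compactSpace.1 (isCompact_range hec)
  haveI : Nonempty (range e) := ⟨⟨e x0, x0, rfl⟩⟩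
  have hk := kuratowskiEmbedding.isometry (range e)
  refine ⟨_, inferInstance, fun x => kuratowskiEmbedding (range e) ⟨e x, x, rfl⟩, ?_,
    ⟨x0, x1, ?_⟩, ?_⟩
  · exact hk.continuous.comp (hec.subtype_mk _)
  · intro h
    have h1 : e x0 = e x1 := congrArg Subtype.val (hk.injective h)
    apply hne
    have h2 := he x0 1
    rw [h1, he, one_app, one_app] at h2
    exact h2.symm
  · intro g x x'
    rw [hk.dist_eq, hk.dist_eq]
    exact hiso g x x'

end

end DistalFactor


instance Homeomorph.instGroupSelf {X : Type*} [TopologicalSpace X] : Group (X ≃ₜ X) where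
  mul a b := b.trans a
  one := Homeomorph.refl X
  inv := Homeomorph.symm
  mul_assoc _ _ _ := rfl
  one_mul a := Homeomorph.ext fun _ => rfl
  mul_one a := Homeomorph.ext fun _ => rfl
  inv_mul_cancel a := Homeomorph.ext fun x => a.symm_apply_apply x

/-- A distal minimal action of a group `G` on a compact metric space `X` which is not
a single point admits a nontrivial equicontinuous (minimal) factor. -/
theorem distal_minimal_has_nontrivial_equicontinuous_factor
    (G : Type*) [Group G]
    (X : Type*) [MetricSpace X] [CompactSpace X]
    (hX : ∃ x x' : X, x ≠ x')
    (φ : G →* (X ≃ₜ X))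
    (hdistal : ∀ x x' : X, x ≠ x' → 0 < ⨅ g : G, dist (φ g x) (φ g x'))
    (hmin : ∀ x : X, Dense (Set.range fun g : G => φ g x)) :
    ∃ (Y : Type) (_ : MetricSpace Y) (_ : CompactSpace Y) (ψ : G →* (Y ≃ₜ Y)),
      (∃ y y' : Y, y ≠ y') ∧
      (∀ ε > (0 : ℝ), ∃ δ > (0 : ℝ), ∀ y y' : Y, dist y y' < δ →
        ∀ g : G, dist (ψ g y) (ψ g y') < ε) ∧
      (∀ y : Y, Dense (Set.range fun g : G => ψ g y)) ∧
      (∃ f : X → Y, Continuous f ∧ Function.Surjective f ∧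
        ∀ (g : G) (x : X), f (φ g x) = ψ g (f x)) := by
  classical
  obtain ⟨Z, _, f, hf, ⟨x0, x1, hne⟩, hiso⟩ := DistalFactor.exists_map hdistal hmin hX
  let c : Set.range f → X := fun y => y.2.choose
  have hc : ∀ y : Set.range f, f (c y) = y := fun y => y.2.choose_spec
  let a : G → Set.range f → Set.range f := fun g y => ⟨f (φ g (c y)), _, rfl⟩
  have ha : ∀ g x, a g ⟨f x, x, rfl⟩ = ⟨f (φ g x), _, rfl⟩ := by
    intro g x
    apply Subtype.ext
    apply dist_eq_zero.1
    show dist (f (φ g (c _))) (f (φ g x)) = 0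
    rw [hiso, hc, dist_self]
  have hsurj : ∀ y : Set.range f, ∃ x, y = ⟨f x, x, rfl⟩ := by
    rintro ⟨_, x, rfl⟩
    exact ⟨x, rfl⟩
  have hai : ∀ g, Isometry (a g) := by
    intro g
    refine Isometry.of_dist_eq fun y y' => ?_
    obtain ⟨x, rfl⟩ := hsurj y
    obtain ⟨x', rfl⟩ := hsurj y'
    rw [ha, ha]
    exact hiso g x x'
  have hmul : ∀ g h y, a (g * h) y = a g (a h y) := by
    intro g h y
    obtain ⟨x, rfl⟩ := hsurj y
    have h1 := ha (g * h) x
    simp only [DistalFactor.mul_app] at h1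
    exact h1.trans ((ha g (φ h x)).symm.trans (congrArg (a g) (ha h x).symm))
  have hone : ∀ y, a 1 y = y := by
    intro y
    obtain ⟨x, rfl⟩ := hsurj y
    rw [ha]
    simp only [DistalFactor.one_app]
  let ψ : G →* (Set.range f ≃ₜ Set.range f) :=
    { toFun := fun g =>
        { toFun := a g
          invFun := a g⁻¹
          left_inv := fun y => by rw [← hmul, inv_mul_cancel, hone]
          right_inv := fun y => by rw [← hmul, mul_inv_cancel, hone]
          continuous_toFun := (hai g).continuous
          continuous_invFun := (hai g⁻¹).continuous }
      map_one' := Homeomorph.ext fun y => hone y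
      map_mul' := fun g h => Homeomorph.ext fun y => hmul g h y }
  have hψ : ∀ g y, ψ g y = a g y := fun g y => rfl
  have hfc : Continuous (fun x : X => (⟨f x, x, rfl⟩ : Set.range f)) := hf.subtype_mk _
  have hfs : Function.Surjective (fun x : X => (⟨f x, x, rfl⟩ : Set.range f)) := by
    rintro ⟨_, x, rfl⟩
    exact ⟨x, rfl⟩
  refine ⟨Set.range f, inferInstance, isCompact_iff_compactSpace.1 (isCompact_range hf), ψ,
    ⟨⟨f x0, x0, rfl⟩, ⟨f x1, x1, rfl⟩, fun h => hne (congrArg Subtype.val h)⟩, ?_, ?_,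
    fun x => ⟨f x, x, rfl⟩, hfc, hfs, fun g x => (ha g x).symm⟩
  · intro ε hε
    refine ⟨ε, hε, fun y y' h g => ?_⟩
    rw [hψ, hψ, (hai g).dist_eq]
    exact h
  · intro y
    obtain ⟨x, rfl⟩ := hsurj y
    have h1 := hfs.denseRange.dense_image hfc (hmin x)
    refine h1.mono ?_
    rintro _ ⟨_, ⟨g, rfl⟩, rfl⟩
    exact ⟨g, ha g x⟩
end

section
/- Let S be a closed surface (a compact connected 2-dimensional topological manifold without boundary), let M be a topological manifold of dimension m, and suppose there exists a continuous open surjection f : S → M. Then m ≤ 2. -/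
namespace OSS

open Set Filter Topology Metric MeasureTheory


theorem tietze {X : Type*} [TopologicalSpace X] [NormalSpace X] {s : Set X} (hs : IsClosed s)
    {g : X → ℂ} (hg : ContinuousOn g s) : ∃ G : X → ℂ, Continuous G ∧ EqOn G g s := by
  obtain ⟨G, hG⟩ := ContinuousMap.exists_restrict_eq hs (⟨s.domRestrict g, hg.domRestrict⟩ : C(s, ℂ))
  refine ⟨G, G.continuous, fun x hx => ?_⟩
  exact DFunLike.congr_fun hG ⟨x, hx⟩

theorem sard {P : ℂ → ℂ} (hP : ContDiff ℝ 1 P) :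
    Dense (P '' {x | (fderiv ℝ P x).det = 0})ᶜ := by
  have h : volume (P '' {x | (fderiv ℝ P x).det = 0}) = 0 := by
    refine addHaar_image_eq_zero_of_det_fderivWithin_eq_zero volume
      (f' := fun x => fderiv ℝ P x) ?_ ?_
    · intro x _
      exact ((hP.differentiable (by simp)) x).hasFDerivAt.hasFDerivWithinAt
    · intro x hx; exact hx
  exact Measure.dense_of_ae (compl_mem_ae_iff.2 h)

theorem finite_zeros {P : ℂ → ℂ} (hP : ContDiff ℝ 1 P) {c : ℂ}
    (hc : c ∉ P '' {x | (fderiv ℝ P x).det = 0}) {D : Set ℂ} (hD : IsCompact D) :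
    (D ∩ {x | P x = c}).Finite := by
  have hcl : IsClosed {x | P x = c} := isClosed_eq hP.continuous continuous_const
  by_contra hinf
  obtain ⟨x, hx, hacc⟩ := Set.Infinite.exists_accPt_of_subset_isCompact hinf hD inter_subset_left
  have hxc : P x = c := by
    have : x ∈ closure {x | P x = c} :=
      mem_closure_iff_clusterPt.2 (hacc.mono (principal_mono.2 inter_subset_right)).clusterPt
    rwa [hcl.closure_eq] at this
  have hdet : (fderiv ℝ P x).det ≠ 0 := fun h => hc ⟨x, h, hxc⟩
  have hd := ((hP.differentiable (by simp)) x).hasFDerivAt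
  have hne : ∀ᶠ z in 𝓝[≠] x, P z ≠ c := by
    apply hd.eventually_ne
    exact ⟨_, ((fderiv ℝ P x).toContinuousLinearEquivOfDetNeZero hdet).antilipschitz⟩
  rw [accPt_iff_frequently_nhdsNE] at hacc
  exact hacc (hne.mono fun z hz h => hz h.2)

theorem lemmaG {X D : Set ℂ} (hX : IsCompact X) (hD : IsCompact D) {F : ℂ → ℂ}
    (hF : ContinuousOn F X) (h0 : ∀ x ∈ X, F x ≠ 0) :
    ∃ G : ℂ → ℂ, Continuous G ∧ EqOn G F X ∧ (D ∩ {x | G x = 0}).Finite := by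
  obtain ⟨F1, hF1, hF1e⟩ := tietze hX.isClosed hF
  obtain ⟨δ, hδ, hδF⟩ : ∃ δ > 0, ∀ x ∈ X, δ ≤ ‖F x‖ := by
    rcases X.eq_empty_or_nonempty with rfl | hne
    · exact ⟨1, one_pos, by simp⟩
    · obtain ⟨x, hx, hmin⟩ := hX.exists_isMinOn hne hF.norm
      exact ⟨‖F x‖, norm_pos_iff.2 (h0 x hx), fun y hy => hmin hy⟩
  obtain ⟨P, hP, hPa, -⟩ := hF1.exists_contDiff_approx 1 (ε := fun _ => δ / 2) continuous_const
    (fun _ => by positivity)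
  obtain ⟨c, hc, hcδ⟩ := (sard hP).exists_dist_lt 0 (ε := δ / 2) (by positivity)
  have hfin := finite_zeros hP hc hD
  have hclose : ∀ x ∈ X, ‖(P x - c) / F x - 1‖ < 1 := by
    intro x hx
    have hFx := h0 x hx
    have : (P x - c) / F x - 1 = (P x - F1 x - c) / F x := by
      rw [hF1e hx]; field_simp; ring
    rw [this, norm_div, div_lt_one (norm_pos_iff.2 hFx)]
    calc ‖P x - F1 x - c‖ ≤ ‖P x - F1 x‖ + ‖c‖ := norm_sub_le _ _
      _ < δ / 2 + δ / 2 := by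
        have h1 := hPa x
        rw [dist_eq_norm] at h1
        have h2 : ‖c‖ < δ / 2 := by simpa [dist_eq_norm] using hcδ
        exact add_lt_add h1 h2
      _ = δ := by ring
      _ ≤ _ := hδF x hx
  have hslit : ∀ x ∈ X, (P x - c) / F x ∈ Complex.slitPlane := by
    intro x hx
    apply Complex.mem_slitPlane_of_norm_lt_one (z := (P x - c) / F x - 1) (hclose x hx) |> fun h => ?_
    simpa using h
  have hlogc : ContinuousOn (fun x => Complex.log ((P x - c) / F x)) X := by
    refine ContinuousOn.clog ?_ hslit
    exact ((hP.continuous.continuousOn).sub continuousOn_const).div hF h0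
  obtain ⟨u, hu, hue⟩ := tietze hX.isClosed hlogc
  refine ⟨fun x => (P x - c) * Complex.exp (-u x), ?_, ?_, ?_⟩
  · have := hP.continuous
    fun_prop
  · intro x hx
    have hs := Complex.slitPlane_ne_zero (hslit x hx)
    have hFx := h0 x hx
    have hPc : P x - c ≠ 0 := fun h => hs (by rw [h]; simp)
    simp only [hue hx]
    rw [Complex.exp_neg, Complex.exp_log hs]
    field_simp
  · refine hfin.subset ?_
    rintro x ⟨hx, hx0⟩
    refine ⟨hx, ?_⟩
    simp only [mem_ofPred_eq, mul_eq_zero, Complex.exp_ne_zero, or_false] at hx0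
    exact sub_eq_zero.1 hx0


theorem glue {X : Type*} [TopologicalSpace X] [NormalSpace X] {s t : Set X} (hs : IsClosed s)
    (ht : IsClosed t) {g h : X → ℂ} (hg : ContinuousOn g s) (hh : ContinuousOn h t)
    (hst : ∀ x ∈ s, x ∈ t → g x = h x) :
    ∃ G : X → ℂ, Continuous G ∧ EqOn G g s ∧ EqOn G h t := by
  classical
  have e1 : EqOn (s.piecewise g h) g s := fun x hx => piecewise_eq_of_mem _ _ _ hx
  have e2 : EqOn (s.piecewise g h) h t := by
    intro x hx
    by_cases hxs : x ∈ s
    · rw [piecewise_eq_of_mem _ _ _ hxs, hst x hxs hx]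
    · rw [piecewise_eq_of_notMem _ _ _ hxs]
  obtain ⟨G, hG, hGe⟩ := tietze (hs.union ht)
    ((hg.congr e1).union_of_isClosed (hh.congr e2) hs ht)
  exact ⟨G, hG, fun x hx => (hGe (Or.inl hx)).trans (e1 hx),
    fun x hx => (hGe (Or.inr hx)).trans (e2 hx)⟩

section surf
variable {S : Type*} [TopologicalSpace S] [T2Space S] [CompactSpace S]

theorem mem_cell (e : OpenPartialHomeomorph S ℂ) {A : Set ℂ} (hA : A ⊆ e.target) {x : S} :
    x ∈ e.symm '' A ↔ x ∈ e.source ∧ e x ∈ A := by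
  constructor
  · rintro ⟨p, hp, rfl⟩
    exact ⟨e.map_target (hA hp), by rwa [e.right_inv (hA hp)]⟩
  · rintro ⟨h1, h2⟩
    exact ⟨e x, h2, e.left_inv h1⟩

theorem isCompact_cell (e : OpenPartialHomeomorph S ℂ) {A : Set ℂ} (hA : A ⊆ e.target)
    (hc : IsCompact A) : IsCompact (e.symm '' A) :=
  hc.image_of_continuousOn (e.continuousOn_symm.mono hA)

theorem isOpen_cell (e : OpenPartialHomeomorph S ℂ) {A : Set ℂ} (hA : A ⊆ e.target)
    (hc : IsOpen A) : IsOpen (e.symm '' A) :=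
  e.symm.isOpen_image_of_subset_source hc hA

theorem continuousOn_cell (e : OpenPartialHomeomorph S ℂ) {A : Set ℂ} (hA : A ⊆ e.target)
    {G : ℂ → ℂ} (hG : ContinuousOn G A) : ContinuousOn (fun x => G (e x)) (e.symm '' A) := by
  refine hG.comp (e.continuousOn.mono ?_) ?_
  · intro x hx; exact ((mem_cell e hA).1 hx).1
  · intro x hx; exact ((mem_cell e hA).1 hx).2

theorem step (e : OpenPartialHomeomorph S ℂ) {v : ℂ} {r : ℝ} (hr : closedBall v r ⊆ e.target)
    {K E : Set S} (hK : IsClosed K) (hE : IsClosed E) {H : S → ℂ} (hH : Continuous H)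
    (hHK : ∀ x ∈ K, H x ≠ 0) (hfin : (E ∩ {x | H x = 0}).Finite)
    (hsph : ∀ x ∈ e.symm '' sphere v r, x ∈ E → H x ≠ 0) :
    ∃ H' : S → ℂ, Continuous H' ∧ EqOn H' H K ∧
      ((E ∪ e.symm '' closedBall v r) ∩ {x | H' x = 0}).Finite := by
  have hsc : e.symm '' sphere v r ⊆ e.symm '' closedBall v r := image_mono sphere_subset_closedBall
  have hbt : ball v r ⊆ e.target := ball_subset_closedBall.trans hr
  set X : Set ℂ := (closedBall v r ∩ e.symm ⁻¹' K) ∪ (sphere v r ∩ e.symm ⁻¹' E) with hXdef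
  have hcs := e.continuousOn_symm.mono hr
  have hX : IsCompact X := by
    refine IsCompact.union ?_ ?_
    · exact (isCompact_closedBall v r).of_isClosed_subset
        (hcs.preimage_isClosed_of_isClosed isClosed_closedBall hK) inter_subset_left
    · exact (isCompact_sphere v r).of_isClosed_subset
        ((hcs.mono sphere_subset_closedBall).preimage_isClosed_of_isClosed isClosed_sphere hE)
        inter_subset_left
  have hXr : X ⊆ closedBall v r := by
    rintro p (⟨hp, -⟩ | ⟨hp, -⟩)
    · exact hp
    · exact sphere_subset_closedBall hp
  obtain ⟨G, hG, hGe, hGf⟩ := lemmaG hX (isCompact_closedBall v r) (F := fun p => H (e.symm p))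
    (hH.comp_continuousOn (hcs.mono hXr)) (by
      rintro p (⟨hp, hpK⟩ | ⟨hp, hpE⟩)
      · exact hHK _ hpK
      · exact hsph _ ⟨p, hp, rfl⟩ hpE)
  have hDc := (isCompact_cell e hr (isCompact_closedBall v r)).isClosed
  have ht : IsClosed (K ∪ (E \ e.symm '' ball v r)) :=
    hK.union (hE.sdiff (isOpen_cell e hbt isOpen_ball))
  obtain ⟨H', hH', h1, h2⟩ := glue hDc ht (g := fun x => G (e x)) (h := H)
    (continuousOn_cell e hr hG.continuousOn) hH.continuousOn (by
      intro x hx hx2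
      obtain ⟨hxs, hxb⟩ := (mem_cell e hr).1 hx
      have : e x ∈ X := by
        rcases hx2 with hx2 | ⟨hx2, hx3⟩
        · exact Or.inl ⟨hxb, by simpa [e.left_inv hxs] using hx2⟩
        · refine Or.inr ⟨?_, by simpa [e.left_inv hxs] using hx2⟩
          rw [mem_cell e hbt] at hx3
          have : e x ∉ ball v r := fun h => hx3 ⟨hxs, h⟩
          rw [mem_ball, not_lt] at this
          exact le_antisymm hxb this
      have := hGe this
      simpa [e.left_inv hxs] using this)
  refine ⟨H', hH', fun x hx => h2 (Or.inl hx), ?_⟩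
  refine (hfin.union (hGf.image e.symm)).subset ?_
  rintro x ⟨hx, hx0⟩
  by_cases hxD : x ∈ e.symm '' closedBall v r
  · right
    obtain ⟨hxs, hxb⟩ := (mem_cell e hr).1 hxD
    exact ⟨e x, ⟨hxb, by rw [← hx0]; exact (h1 hxD).symm⟩, e.left_inv hxs⟩
  · left
    rcases hx with hx | hx
    · refine ⟨hx, ?_⟩
      have := h2 (Or.inr ⟨hx, fun h => hxD (image_mono ball_subset_closedBall h)⟩)
      rw [← hx0]; exact this.symm
    · exact absurd hx hxD

/-- radii avoiding a finite set -/
theorem exists_radius (e : OpenPartialHomeomorph S ℂ) (v : ℂ) {a b : ℝ} (hab : a < b)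
    (hb : closedBall v b ⊆ e.target)
    {A : Set S} (hA : A.Finite) :
    ∃ r, a < r ∧ r < b ∧ ∀ x ∈ e.symm '' sphere v r, x ∉ A := by
  have hf : ((fun x => dist (e x) v) '' A).Finite := hA.image _
  obtain ⟨r, hr, hr2⟩ := (Ioo_infinite hab).exists_notMem_finite hf
  refine ⟨r, hr.1, hr.2, fun x hx hxA => hr2 ⟨x, hxA, ?_⟩⟩
  have : sphere v r ⊆ e.target :=
    (sphere_subset_closedBall.trans (closedBall_subset_closedBall hr.2.le)).trans hb
  exact ((mem_cell e this).1 hx).2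

theorem exists_finite_zeros (hch : ∀ x : S, ∃ e : OpenPartialHomeomorph S ℂ, x ∈ e.source)
    {K : Set S} (hK : IsClosed K) {g : S → ℂ} (hg : ContinuousOn g K)
    (hg0 : ∀ x ∈ K, g x ≠ 0) :
    ∃ H : S → ℂ, Continuous H ∧ EqOn H g K ∧ {x | H x = 0}.Finite := by
  choose e he using hch
  have hR : ∀ x, ∃ R > 0, closedBall (e x x) R ⊆ (e x).target := fun x =>
    nhds_basis_closedBall.mem_iff.1 ((e x).open_target.mem_nhds ((e x).map_source (he x)))
  choose R hR0 hRt using hR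
  have hb : ∀ x, ball (e x x) (R x / 2) ⊆ (e x).target := fun x =>
    (ball_subset_closedBall.trans (closedBall_subset_closedBall (by linarith [hR0 x]))).trans (hRt x)
  have hc : ∀ x, closedBall (e x x) (R x / 2) ⊆ (e x).target := fun x =>
    ((closedBall_subset_closedBall (by linarith [hR0 x]))).trans (hRt x)
  obtain ⟨t, ht⟩ := isCompact_univ.elim_nhds_subcover
    (fun x => (e x).symm '' closedBall (e x x) (R x / 2)) (fun x _ => by
      refine mem_of_superset ((isOpen_cell (e x) (hb x) isOpen_ball).mem_nhds ?_)
        (image_mono ball_subset_closedBall)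
      exact ⟨e x x, mem_ball_self (by linarith [hR0 x]), (e x).left_inv (he x)⟩)
  have key : ∀ t : Finset S, ∃ H : S → ℂ, Continuous H ∧ EqOn H g K ∧
      ((⋃ x ∈ t, (e x).symm '' closedBall (e x x) (R x / 2)) ∩ {x | H x = 0}).Finite := by
    intro t
    classical
    induction t using Finset.induction_on with
    | empty =>
      obtain ⟨H, hH, hHe⟩ := tietze hK hg
      exact ⟨H, hH, hHe, by simp⟩
    | insert a t _ ih =>
      obtain ⟨H, hH, hHe, hf⟩ := ih
      set E := ⋃ x ∈ t, (e x).symm '' closedBall (e x x) (R x / 2) with hEdef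
      have hE : IsClosed E := t.finite_toSet.isClosed_biUnion fun x _ =>
        (isCompact_cell (e x) (hc x) (isCompact_closedBall _ _)).isClosed
      obtain ⟨r, hr1, hr2, hr3⟩ := exists_radius (e a) (e a a) (a := R a / 2) (b := R a)
        (by linarith [hR0 a]) (hRt a) hf
      obtain ⟨H', hH', h1, h2⟩ := step (e a) (v := e a a) (r := r)
        ((closedBall_subset_closedBall hr2.le).trans (hRt a)) hK hE hH
        (fun x hx => by rw [hHe hx]; exact hg0 x hx) hf
        (fun x hx hxE h0 => hr3 x hx ⟨hxE, h0⟩)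
      refine ⟨H', hH', h1.trans hHe, h2.subset ?_⟩
      refine inter_subset_inter_left _ ?_
      rw [Finset.set_biUnion_insert]
      exact union_subset ((image_mono (closedBall_subset_closedBall hr1.le)).trans
        subset_union_right) subset_union_left
  obtain ⟨H, hH, h1, h2⟩ := key t
  refine ⟨H, hH, h1, h2.subset fun x hx => ⟨?_, hx⟩⟩
  have := ht.2 (mem_univ x)
  simpa using this

end surf


section surf2
variable {S : Type*} [TopologicalSpace S] [T2Space S] [CompactSpace S]

theorem cone (e : OpenPartialHomeomorph S ℂ) {v : ℂ} {r : ℝ} (hr0 : 0 < r)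
    (hr : closedBall v r ⊆ e.target) {H : S → ℂ} (hH : Continuous H)
    (hsph : ∀ x ∈ e.symm '' sphere v r, H x ≠ 0) :
    ∃ H' : S → ℂ, Continuous H' ∧ (∀ x, x ∉ e.symm '' ball v r → H' x = H x) ∧
      (∀ x ∈ e.symm '' closedBall v r, H' x = 0 → x = e.symm v) := by
  have hbt : ball v r ⊆ e.target := ball_subset_closedBall.trans hr
  set q : ℂ → ℂ := fun p => v + ((r / ‖p - v‖ : ℝ) : ℂ) * (p - v) with hq
  have hqs : ∀ p, p ≠ v → q p ∈ sphere v r := by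
    intro p hp
    have : ‖p - v‖ ≠ 0 := norm_ne_zero_iff.2 (sub_ne_zero.2 hp)
    rw [mem_sphere, dist_eq_norm, hq]
    simp only [add_sub_cancel_left, norm_mul, Complex.norm_real, norm_div, norm_norm,
      Real.norm_of_nonneg hr0.le]
    field_simp
  set G : ℂ → ℂ := fun p => ((‖p - v‖ / r : ℝ) : ℂ) * H (e.symm (q p)) with hGdef
  have hGc : ContinuousOn G (closedBall v r) := by
    intro p hp
    by_cases hpv : p = v
    · subst hpv
      obtain ⟨C, hC⟩ := isCompact_univ.exists_bound_of_continuousOn hH.continuousOn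
      have hG0 : G p = 0 := by simp [hGdef]
      apply ContinuousAt.continuousWithinAt
      rw [ContinuousAt, hG0]
      apply squeeze_zero_norm (a := fun z => ‖z - p‖ / r * C)
      · intro z
        simp only [hGdef, norm_mul, Complex.norm_real, norm_div, norm_norm,
          Real.norm_of_nonneg hr0.le]
        gcongr
        exact hC _ (mem_univ _)
      · have : Continuous fun z : ℂ => ‖z - p‖ / r * C := by fun_prop
        have := this.tendsto p
        simpa using this
    · have hne : ‖p - v‖ ≠ 0 := norm_ne_zero_iff.2 (sub_ne_zero.2 hpv)
      have hqc : ContinuousAt q p := by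
        have : ContinuousAt (fun p => r / ‖p - v‖) p :=
          ContinuousAt.div (by fun_prop) (by fun_prop) hne
        have h2 : ContinuousAt (fun p => ((r / ‖p - v‖ : ℝ) : ℂ)) p :=
          Complex.continuous_ofReal.continuousAt.comp this
        exact continuousAt_const.add (h2.mul (by fun_prop))
      have hes : ContinuousAt e.symm (q p) :=
        e.continuousAt_symm (hr (sphere_subset_closedBall (hqs p hpv)))
      have h3 : ContinuousAt (fun p => H (e.symm (q p))) p :=
        hH.continuousAt.comp (hes.comp hqc)
      have h4 : ContinuousAt (fun p => ((‖p - v‖ / r : ℝ) : ℂ)) p := by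
        have : Continuous (fun p : ℂ => ((‖p - v‖ / r : ℝ) : ℂ)) := by fun_prop
        exact this.continuousAt
      exact (h4.mul h3).continuousWithinAt
  have hDc := (isCompact_cell e hr (isCompact_closedBall v r)).isClosed
  obtain ⟨H', hH', h1, h2⟩ := glue hDc (isOpen_cell e hbt isOpen_ball).isClosed_compl
    (g := fun x => G (e x)) (h := H)
    (continuousOn_cell e hr hGc) hH.continuousOn (by
      intro x hx hx3
      obtain ⟨hxs, hxb⟩ := (mem_cell e hr).1 hx
      rw [mem_compl_iff, mem_cell e hbt] at hx3
      have : e x ∉ ball v r := fun h => hx3 ⟨hxs, h⟩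
      rw [mem_ball, not_lt] at this
      have hd : ‖e x - v‖ = r := by
        rw [← dist_eq_norm]; exact le_antisymm hxb this
      simp [hGdef, hq, hd, hr0.ne', e.left_inv hxs])
  refine ⟨H', hH', fun x hx => h2 hx, fun x hx hx0 => ?_⟩
  rw [h1 hx] at hx0
  obtain ⟨hxs, hxb⟩ := (mem_cell e hr).1 hx
  by_contra hne
  have hev : e x ≠ v := fun h => hne (by rw [← h, e.left_inv hxs])
  simp only [hGdef, mul_eq_zero] at hx0
  rcases hx0 with h | h
  · have : ‖e x - v‖ ≠ 0 := norm_ne_zero_iff.2 (sub_ne_zero.2 hev)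
    rw [Complex.ofReal_eq_zero, div_eq_zero_iff] at h
    exact h.elim this hr0.ne'
  · exact hsph _ ⟨_, hqs _ hev, rfl⟩ h

/-- zeros can be moved from `a` to `b` without changing the function on `K` -/
def Movable (K : Set S) (a b : S) : Prop :=
  ∀ H : S → ℂ, Continuous H → ∀ C : Set S, C.Finite → {x | H x = 0} ⊆ insert a C →
    ∃ H' : S → ℂ, Continuous H' ∧ EqOn H' H K ∧ {x | H' x = 0} ⊆ insert b C

theorem movable_local (hch : ∀ x : S, ∃ e : OpenPartialHomeomorph S ℂ, x ∈ e.source)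
    {K : Set S} (hK : IsClosed K) {b : S} (hb : b ∉ K) :
    ∃ N ∈ 𝓝 b, ∀ u ∈ N, ∀ v ∈ N, Movable K u v := by
  obtain ⟨e, he⟩ := hch b
  have hm : e.symm ⁻¹' Kᶜ ∩ e.target ∈ 𝓝 (e b) := by
    refine inter_mem ?_ (e.open_target.mem_nhds (e.map_source he))
    refine (e.continuousAt_symm (e.map_source he)).preimage_mem_nhds ?_
    rw [e.left_inv he]
    exact hK.isOpen_compl.mem_nhds hb
  obtain ⟨R, hR0, hR⟩ := nhds_basis_closedBall.mem_iff.1 hm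
  have hbt : ball (e b) (R / 4) ⊆ e.target := by
    refine (ball_subset_closedBall.trans (closedBall_subset_closedBall ?_)).trans
      (hR.trans inter_subset_right)
    linarith
  refine ⟨e.symm '' ball (e b) (R / 4), (isOpen_cell e hbt isOpen_ball).mem_nhds
    ⟨e b, mem_ball_self (by linarith), e.left_inv he⟩, ?_⟩
  intro u hu v hv H hH C hC hz
  obtain ⟨hus, hub⟩ := (mem_cell e hbt).1 hu
  obtain ⟨hvs, hvb⟩ := (mem_cell e hbt).1 hv
  rw [mem_ball] at hub hvb
  have hsub : closedBall (e v) (3 * R / 4) ⊆ closedBall (e b) R :=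
    closedBall_subset_closedBall' (by linarith)
  have hsubt : closedBall (e v) (3 * R / 4) ⊆ e.target :=
    hsub.trans (hR.trans inter_subset_right)
  obtain ⟨r, hr1, hr2, hr3⟩ := exists_radius e (e v) (a := R / 2) (b := 3 * R / 4)
    (by linarith) hsubt (hC.insert u)
  have hrt : closedBall (e v) r ⊆ e.target := (closedBall_subset_closedBall hr2.le).trans hsubt
  obtain ⟨H', hH', h1, h2⟩ := cone e (v := e v) (r := r) (by linarith) hrt hH
    (fun x hx h0 => hr3 x hx (hz h0))
  refine ⟨H', hH', ?_, ?_⟩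
  · intro x hx
    apply h1
    intro hx'
    obtain ⟨p, hp, rfl⟩ := hx'
    exact (hR (hsub (closedBall_subset_closedBall hr2.le (ball_subset_closedBall hp)))).1 hx
  · intro x hx
    by_cases hxD : x ∈ e.symm '' closedBall (e v) r
    · left
      rw [h2 x hxD hx, e.left_inv hvs]
    · right
      have hx' : H x = 0 := by
        rw [← h1 x (fun h => hxD (image_mono ball_subset_closedBall h))]; exact hx
      refine (hz hx').resolve_left ?_
      rintro rfl
      apply hxD
      rw [mem_cell e hrt]
      refine ⟨hus, ?_⟩
      rw [mem_closedBall]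
      have := dist_triangle_right (e x) (e v) (e b)
      linarith

theorem movable_of_preconnected
    (hch : ∀ x : S, ∃ e : OpenPartialHomeomorph S ℂ, x ∈ e.source)
    {K U : Set S} (hK : IsClosed K) (hU : IsPreconnected U) (hUK : U ⊆ Kᶜ)
    {a b : S} (ha : a ∈ U) (hb : b ∈ U) : Movable K a b := by
  refine hU.induction₂' (Movable K) ?_ ?_ ha hb
  · intro x hx
    obtain ⟨N, hN, h⟩ := movable_local hch hK (hUK hx)
    filter_upwards [mem_nhdsWithin_of_mem_nhds hN] with y hy
    exact ⟨h x (mem_of_mem_nhds hN) y hy, h y hy x (mem_of_mem_nhds hN)⟩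
  · intro x y z _ _ _ hxy hyz H hH C hC hz
    obtain ⟨H1, hH1, h1, h1'⟩ := hxy H hH C hC hz
    obtain ⟨H2, hH2, h2, h2'⟩ := hyz H1 hH1 C hC h1'
    exact ⟨H2, hH2, h2.trans h1, h2'⟩

theorem push (hch : ∀ x : S, ∃ e : OpenPartialHomeomorph S ℂ, x ∈ e.source)
    {K W : Set S} (hK : IsClosed K) (hW : W.Finite)
    (hKW : ∀ a ∉ K, ∃ w ∈ W, w ∈ connectedComponentIn Kᶜ a)
    {g : S → ℂ} (hg : ContinuousOn g K) (hg0 : ∀ x ∈ K, g x ≠ 0) :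
    ∃ H : S → ℂ, Continuous H ∧ EqOn H g K ∧ {x | H x = 0} ⊆ W := by
  obtain ⟨H, hH, hHg, hf⟩ := exists_finite_zeros hch hK hg hg0
  have key : ∀ A : Set S, A.Finite → A ⊆ Kᶜ → ∀ H : S → ℂ, Continuous H → EqOn H g K →
      {x | H x = 0} ⊆ A ∪ W → ∃ H : S → ℂ, Continuous H ∧ EqOn H g K ∧ {x | H x = 0} ⊆ W := by
    intro A hA
    induction A, hA using Set.Finite.induction_on with
    | empty => intro _ H hH h1 h2; exact ⟨H, hH, h1, by simpa using h2⟩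
    | @insert a A _ hA ih =>
      intro hAK H hH h1 h2
      have haK : a ∉ K := hAK (mem_insert _ _)
      obtain ⟨w, hwW, hw⟩ := hKW a haK
      have hm : Movable K a w := movable_of_preconnected hch hK isPreconnected_connectedComponentIn
        (connectedComponentIn_subset _ _) (mem_connectedComponentIn haK) hw
      obtain ⟨H', hH', h3, h4⟩ := hm H hH (A ∪ W) (hA.union hW) (by rwa [insert_union] at h2)
      refine ih ((subset_insert _ _).trans hAK) H' hH' (h3.trans h1) ?_
      have hmem : w ∈ A ∪ W := Or.inr hwW
      rwa [insert_eq_of_mem hmem] at h4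
  refine key _ hf ?_ H hH hHg subset_union_left
  intro x hx hxK
  exact hg0 x hxK (by rw [← hHg hxK]; exact hx)

end surf2

section rank
variable {S : Type*} [TopologicalSpace S]

theorem log_ball {v : ℂ} {r : ℝ} (hr : 0 < r) {h : ℂ → ℂ} (hh : ContinuousOn h (ball v r))
    (h0 : ∀ x ∈ ball v r, h x ≠ 0) :
    ∃ θ : ℂ → ℂ, ContinuousOn θ (ball v r) ∧ ∀ x ∈ ball v r, Complex.exp (θ x) = h x := by
  classical
  have : ContractibleSpace (ball v r) :=
    (convex_ball v r).contractibleSpace ⟨v, mem_ball_self hr⟩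
  have : LocallyPathConnectedSpace (ball v r) := isOpen_ball.locallyPathConnectedSpace
  let F : C(ball v r, {z : ℂ // z ≠ 0}) :=
    ⟨fun x => ⟨h x, h0 x x.2⟩, Continuous.subtype_mk hh.domRestrict _⟩
  let a₀ : ball v r := ⟨v, mem_ball_self hr⟩
  obtain ⟨G, ⟨-, hG⟩, -⟩ := Complex.isCoveringMap_exp.existsUnique_continuousMap_lifts F a₀
    (Complex.log (h v)) (Subtype.ext (Complex.exp_log (h0 v (mem_ball_self hr))))
  refine ⟨fun x => if hx : x ∈ ball v r then G ⟨x, hx⟩ else 0, ?_, ?_⟩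
  · rw [continuousOn_iff_continuous_domRestrict]
    convert G.continuous using 1
    ext x
    simp [Set.domRestrict]
  · intro x hx
    simp only [dif_pos hx]
    exact congrArg Subtype.val (congrFun hG ⟨x, hx⟩)

theorem int_const {C : Set S} (hC : IsPreconnected C) {a b : S → ℂ} (ha : ContinuousOn a C)
    (hb : ContinuousOn b C) (hab : ∀ x ∈ C, Complex.exp (a x) = Complex.exp (b x)) {p z : S}
    (hp : p ∈ C) (hz : z ∈ C) : a z - b z = a p - b p := by
  have hn : ∀ x ∈ C, ∃ n : ℤ, a x - b x = n * (2 * Real.pi * Complex.I) := by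
    intro x hx
    obtain ⟨n, hn⟩ := Complex.exp_eq_exp_iff_exists_int.1 (hab x hx)
    exact ⟨n, by rw [hn]; ring⟩
  have hpi : (2 * Real.pi * Complex.I : ℂ) ≠ 0 := Complex.two_pi_I_ne_zero
  have hc : ContinuousOn (fun x => ((a x - b x) / (2 * Real.pi * Complex.I)).re) C :=
    Complex.continuous_re.comp_continuousOn ((ha.sub hb).div_const _)
  have he := Int.isClosedEmbedding_coe_real.isEmbedding
  have : DiscreteTopology (range ((↑) : ℤ → ℝ)) := he.toHomeomorph.symm.isEmbedding.discreteTopology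
  have h1 := hC.constant_of_mapsTo (T := range ((↑) : ℤ → ℝ)) ⟨this⟩ hc (by
    intro x hx
    obtain ⟨n, hn⟩ := hn x hx
    exact ⟨n, by simp only [hn]; rw [mul_div_cancel_right₀ _ hpi]; simp⟩) hz hp
  obtain ⟨n, hn1⟩ := hn z hz
  obtain ⟨k, hk⟩ := hn p hp
  simp only [hn1, hk, mul_div_cancel_right₀ _ hpi, Complex.intCast_re, Int.cast_inj] at h1
  rw [hn1, hk, h1]

variable [T2Space S] [CompactSpace S]

theorem exists_cell (hch : ∀ x : S, ∃ e : OpenPartialHomeomorph S ℂ, x ∈ e.source)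
    {Ω : Set S} (hΩ : IsOpen Ω) {x : S} (hx : x ∈ Ω) :
    ∃ D D' : Set S, IsOpen D ∧ IsClosed D' ∧ D' ⊆ D ∧ D' ∈ 𝓝 x ∧ D ⊆ Ω ∧
      ∀ H : S → ℂ, ContinuousOn H D → (∀ y ∈ D, H y ≠ 0) → ∃ θ : S → ℂ, ContinuousOn θ D ∧
        ∀ y ∈ D, Complex.exp (θ y) = H y := by
  obtain ⟨e, he⟩ := hch x
  have hopen : IsOpen (e.target ∩ e.symm ⁻¹' Ω) := e.isOpen_inter_preimage_symm hΩ
  obtain ⟨r, hr, hrt⟩ := Metric.isOpen_iff.1 hopen (e x) ⟨e.map_source he, by simpa [e.left_inv he]⟩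
  have ht : ball (e x) r ⊆ e.target := fun y hy => (hrt hy).1
  have hcb : closedBall (e x) (r/2) ⊆ ball (e x) r := closedBall_subset_ball (by linarith)
  refine ⟨e.symm '' ball (e x) r, e.symm '' closedBall (e x) (r/2), isOpen_cell e ht isOpen_ball,
    (isCompact_cell e (hcb.trans ht) (isCompact_closedBall _ _)).isClosed, image_mono hcb, ?_, ?_, ?_⟩
  · refine mem_of_superset ((isOpen_cell e ((ball_subset_closedBall.trans hcb).trans ht)
      isOpen_ball).mem_nhds ?_) (image_mono (ball_subset_closedBall (ε := r/2) (x := e x)))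
    exact ⟨e x, mem_ball_self (by linarith), e.left_inv he⟩
  · rintro _ ⟨y, hy, rfl⟩; exact (hrt hy).2
  · intro H hH h0
    obtain ⟨θ, h1, h2⟩ := log_ball (h := fun p => H (e.symm p)) hr
      (hH.comp (e.continuousOn_symm.mono ht) (fun y hy => ⟨y, hy, rfl⟩)) (fun y hy => h0 _ ⟨y, hy, rfl⟩)
    refine ⟨fun y => θ (e y), continuousOn_cell e ht h1, ?_⟩
    intro y hy
    have := (mem_cell e ht).1 hy
    rw [h2 _ this.2, e.left_inv this.1]

theorem rank_lemma [LocallyConnectedSpace S]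
    (hch : ∀ x : S, ∃ e : OpenPartialHomeomorph S ℂ, x ∈ e.source)
    {S₀ Ω : Set S} (hS : IsClosed S₀) (hΩ : IsOpen Ω) (hsub : S₀ ⊆ Ω) :
    ∃ N : ℕ, ∀ H : Fin N → S → ℂ, (∀ i, Continuous (H i)) → (∀ i, ∀ x ∈ Ω, H i x ≠ 0) →
      ∃ c : Fin N → ℤ, c ≠ 0 ∧ ∃ L : S → ℂ, ContinuousOn L S₀ ∧
        ∀ x ∈ S₀, Complex.exp (L x) = ∏ i, H i x ^ c i := by
  classical
  have hcell : ∀ x : S, ∃ D D' : Set S, x ∈ S₀ → (IsOpen D ∧ IsClosed D' ∧ D' ⊆ D ∧ D' ∈ 𝓝 x ∧ D ⊆ Ω ∧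
      ∀ H : S → ℂ, ContinuousOn H D → (∀ y ∈ D, H y ≠ 0) → ∃ θ : S → ℂ, ContinuousOn θ D ∧
        ∀ y ∈ D, Complex.exp (θ y) = H y) := by
    intro x
    by_cases hx : x ∈ S₀
    · obtain ⟨D, D', h⟩ := exists_cell hch hΩ (hsub hx)
      exact ⟨D, D', fun _ => h⟩
    · exact ⟨∅, ∅, fun h => absurd h hx⟩
  choose D D' hD using hcell
  obtain ⟨t, htS, ht⟩ := hS.isCompact.elim_nhds_subcover D' (fun x hx => (hD x hx).2.2.2.1)
  have hP : ∀ x y : S, ∃ P : Finset S, x ∈ t → y ∈ t → (∀ p ∈ P, p ∈ D x ∩ D y) ∧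
      D' x ∩ D' y ⊆ ⋃ p ∈ P, connectedComponentIn (D x ∩ D y) p := by
    intro x y
    by_cases h : x ∈ t ∧ y ∈ t
    · have hx := hD x (htS x h.1)
      have hy := hD y (htS y h.2)
      have ho : IsOpen (D x ∩ D y) := hx.1.inter hy.1
      have hs : D' x ∩ D' y ⊆ D x ∩ D y := inter_subset_inter hx.2.2.1 hy.2.2.1
      obtain ⟨P, h1, h2⟩ := (hx.2.1.inter hy.2.1).isCompact.elim_nhds_subcover
        (fun p => connectedComponentIn (D x ∩ D y) p) (fun z hz =>
          ho.connectedComponentIn.mem_nhds (mem_connectedComponentIn (hs hz)))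
      exact ⟨P, fun _ _ => ⟨fun p hp => hs (h1 p hp), h2⟩⟩
    · exact ⟨∅, fun h1 h2 => absurd ⟨h1, h2⟩ h⟩
  choose P hP using hP
  let T : Finset (Σ _ : S × S, S) := (t ×ˢ t).sigma (fun xy => P xy.1 xy.2)
  refine ⟨T.card + 2, fun H hH hH0 => ?_⟩
  have hθ : ∀ i, ∀ x, ∃ θ : S → ℂ, x ∈ t → ContinuousOn θ (D x) ∧
      ∀ y ∈ D x, Complex.exp (θ y) = H i y := by
    intro i x
    by_cases hx : x ∈ t
    · obtain ⟨θ, h⟩ := (hD x (htS x hx)).2.2.2.2.2 (H i) (hH i).continuousOn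
        (fun y hy => hH0 i y ((hD x (htS x hx)).2.2.2.2.1 hy))
      exact ⟨θ, fun _ => h⟩
    · exact ⟨0, fun h => absurd h hx⟩
  choose θ hθ using hθ
  have hA : ∀ (a : Option T) (i : Fin (T.card + 2)), ∃ n : ℤ, ∀ b : T, a = some b →
      θ i b.1.1.1 b.1.2 - θ i b.1.1.2 b.1.2 = n * (2 * Real.pi * Complex.I) := by
    intro a i
    rcases a with _ | ⟨⟨⟨x, y⟩, p⟩, hb⟩
    · exact ⟨0, fun b hb => by simp at hb⟩
    · obtain ⟨hxy, hp⟩ := Finset.mem_sigma.1 hb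
      obtain ⟨hx, hy⟩ := Finset.mem_product.1 hxy
      simp only at hx hy hp
      have hpm := (hP x y hx hy).1 p hp
      obtain ⟨n, hn⟩ := Complex.exp_eq_exp_iff_exists_int.1
        (((hθ i x hx).2 p hpm.1).trans ((hθ i y hy).2 p hpm.2).symm)
      refine ⟨n, ?_⟩
      rintro b h
      obtain rfl := Option.some_injective _ h
      simp only [hn]; ring
  choose A hA using hA
  obtain ⟨c, hc0, hc, -⟩ := Int.Matrix.exists_ne_zero_int_vec_norm_le (Matrix.of A)
    (by simp) (by simp)
  refine ⟨c, hc0, ?_⟩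
  let Θ : S → S → ℂ := fun l x => ∑ i, c i * θ i l x
  have hagree : ∀ l ∈ t, ∀ k ∈ t, ∀ z ∈ D' l ∩ D' k, Θ l z = Θ k z := by
    intro l hl k hk z hz
    obtain ⟨hp1, hp2⟩ := hP l k hl hk
    obtain ⟨p, hp, hzp⟩ := mem_iUnion₂.1 (hp2 hz)
    have hpC := mem_connectedComponentIn (hp1 p hp)
    have hCs := connectedComponentIn_subset (D l ∩ D k) p
    have hd : ∀ i, θ i l z - θ i k z = θ i l p - θ i k p := fun i =>
      int_const isPreconnected_connectedComponentIn
        ((hθ i l hl).1.mono (fun x hx => (hCs hx).1)) ((hθ i k hk).1.mono (fun x hx => (hCs hx).2))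
        (fun x hx => ((hθ i l hl).2 x (hCs hx).1).trans ((hθ i k hk).2 x (hCs hx).2).symm) hpC hzp
    have hbT : (⟨(l, k), p⟩ : Σ _ : S × S, S) ∈ T :=
      Finset.mem_sigma.2 ⟨Finset.mem_product.2 ⟨hl, hk⟩, hp⟩
    have hrow := congrFun hc (some ⟨_, hbT⟩)
    simp only [Matrix.mulVec, dotProduct, Matrix.of_apply, Pi.zero_apply] at hrow
    have hrow' : (∑ i, (A (some ⟨_, hbT⟩) i : ℂ) * (c i : ℂ)) = 0 := by exact_mod_cast hrow
    rw [← sub_eq_zero]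
    calc Θ l z - Θ k z = ∑ i, c i * (θ i l z - θ i k z) := by
          simp only [Θ, mul_sub, Finset.sum_sub_distrib]
      _ = ∑ i, c i * (A (some ⟨_, hbT⟩) i * (2 * Real.pi * Complex.I)) := by
          refine Finset.sum_congr rfl fun i _ => ?_
          rw [hd i]
          congr 1
          exact hA (some ⟨_, hbT⟩) i ⟨_, hbT⟩ rfl
      _ = (∑ i, (A (some ⟨_, hbT⟩) i : ℂ) * (c i : ℂ)) * (2 * Real.pi * Complex.I) := by
          rw [Finset.sum_mul]
          exact Finset.sum_congr rfl fun i _ => by ring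
      _ = 0 := by rw [hrow', zero_mul]
  have hl : ∀ x, ∃ l, x ∈ S₀ → l ∈ t ∧ x ∈ D' l := by
    intro x
    by_cases hx : x ∈ S₀
    · obtain ⟨l, hl, hxl⟩ := mem_iUnion₂.1 (ht hx)
      exact ⟨l, fun _ => ⟨hl, hxl⟩⟩
    · exact ⟨x, fun h => absurd h hx⟩
  choose l hl using hl
  have hLe : ∀ k ∈ t, EqOn (fun x => Θ (l x) x) (Θ k) (D' k ∩ S₀) := by
    intro k hk x hx
    exact hagree _ (hl x hx.2).1 _ hk x ⟨(hl x hx.2).2, hx.1⟩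
  refine ⟨fun x => Θ (l x) x, ?_, ?_⟩
  · have hcov : S₀ ⊆ ⋃ k : t, D' k ∩ S₀ := by
      intro x hx
      exact mem_iUnion.2 ⟨⟨l x, (hl x hx).1⟩, (hl x hx).2, hx⟩
    refine ContinuousOn.mono ?_ hcov
    refine (locallyFinite_of_finite _).continuousOn_iUnion ?_ ?_
    · intro k; exact (hD k (htS k k.2)).2.1.inter hS
    · intro k
      refine ContinuousOn.congr ?_ (hLe k k.2)
      refine continuousOn_finsetSum _ fun i _ => ?_
      exact continuousOn_const.mul ((hθ i k k.2).1.mono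
        (inter_subset_left.trans (hD k (htS k k.2)).2.2.1))
  · intro x hx
    simp only [Θ, Complex.exp_sum]
    refine Finset.prod_congr rfl fun i _ => ?_
    rw [Complex.exp_int_mul, (hθ i _ (hl x hx).1).2 x ((hD _ (htS _ (hl x hx).1)).2.2.1 (hl x hx).2)]

end rank

section geom

theorem ball_diff_preconnected {E : Type*} [NormedAddCommGroup E] [NormedSpace ℝ E]
    [FiniteDimensional ℝ E] (hE : 3 ≤ Module.finrank ℝ E) {ι : Type*} [Finite ι] (γ : ι → ℝ → E)
    (hγ : ∀ i, ContDiff ℝ 1 (γ i)) (c : E) (r : ℝ) :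
    IsPreconnected (ball c r \ ⋃ i, range (γ i)) := by
  have : Countable ι := Finite.to_countable
  set Z := ⋃ i, range (γ i) with hZ
  have hseg : ∀ a ∉ Z, ∀ w, w ∉ (⋃ i, range (fun p : ℝ × ℝ => a + p.1 • (γ i p.2 - a))) →
      Disjoint (segment ℝ a w) Z := by
    intro a ha w hw
    rw [Set.disjoint_left]
    intro x hx hxZ
    rw [segment_eq_image'] at hx
    obtain ⟨s, hs, rfl⟩ := hx
    obtain ⟨i, θ, hθ⟩ := mem_iUnion.1 hxZ
    have hs0 : s ≠ 0 := by
      rintro rfl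
      apply ha
      simpa using hxZ
    apply hw
    refine mem_iUnion.2 ⟨i, (s⁻¹, θ), ?_⟩
    simp only [hθ, add_sub_cancel_left, smul_smul, inv_mul_cancel₀ hs0, one_smul]
    abel
  have hdim : ∀ a, dimH (⋃ i, range (fun p : ℝ × ℝ => a + p.1 • (γ i p.2 - a))) ≤ 2 := by
    intro a
    rw [dimH_iUnion]
    refine iSup_le fun i => ?_
    have hcd : ContDiff ℝ 1 (fun p : ℝ × ℝ => a + p.1 • (γ i p.2 - a)) :=
      contDiff_const.add (contDiff_fst.smul (((hγ i).comp contDiff_snd).sub contDiff_const))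
    refine hcd.dimH_range_le.trans ?_
    simp
  refine isPreconnected_of_forall_pair ?_
  rintro a ⟨haB, haZ⟩ b ⟨hbB, hbZ⟩
  have hd : Dense ((⋃ i, range (fun p : ℝ × ℝ => a + p.1 • (γ i p.2 - a))) ∪
      (⋃ i, range (fun p : ℝ × ℝ => b + p.1 • (γ i p.2 - b))))ᶜ := by
    apply dense_compl_of_dimH_lt_finrank
    rw [dimH_union]
    refine lt_of_le_of_lt (max_le (hdim a) (hdim b)) ?_
    have : (2 : ℕ) < Module.finrank ℝ E := hE
    exact_mod_cast this
  obtain ⟨w, hwB, hw⟩ := hd.exists_mem_open isOpen_ball ⟨a, haB⟩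
  rw [compl_union] at hwB
  have h1 := hseg a haZ w hwB.1
  have h2 := hseg b hbZ w hwB.2
  refine ⟨segment ℝ a w ∪ segment ℝ b w, ?_, Or.inl (left_mem_segment _ _ _),
    Or.inr (left_mem_segment _ _ _), ?_⟩
  · refine union_subset ?_ ?_
    · exact fun x hx => ⟨(convex_ball c r).segment_subset haB hw hx, Set.disjoint_left.1 h1 hx⟩
    · exact fun x hx => ⟨(convex_ball c r).segment_subset hbB hw hx, Set.disjoint_left.1 h2 hx⟩
  · exact IsPreconnected.union w (right_mem_segment _ _ _) (right_mem_segment _ _ _)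
      (convex_segment a w).isPreconnected (convex_segment b w).isPreconnected

theorem compl_preconnected {M : Type*} [TopologicalSpace M] [PreconnectedSpace M] {Z O : Set M}
    (hZ : IsClosed Z) (hO : IsOpen O) (hZO : Z ⊆ O) (hOZ : IsPreconnected (O \ Z)) :
    IsPreconnected Zᶜ := by
  have key : ∀ u v : Set M, IsOpen u → IsOpen v → Zᶜ ⊆ u ∪ v → Zᶜ ∩ (u ∩ v) = ∅ → O \ Z ⊆ u →
      Zᶜ ⊆ u ∨ Zᶜ ⊆ v := by
    intro u v hu hv huv hd hOu
    have hcl : IsClopen (v ∩ Zᶜ) := by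
      refine ⟨?_, hv.inter hZ.isOpen_compl⟩
      have : v ∩ Zᶜ = ((u ∩ Zᶜ) ∪ O)ᶜ := by
        ext x
        constructor
        · rintro ⟨h1, h2⟩ (h3 | h3)
          · exact (hd.subset ⟨h2, h3.1, h1⟩ : x ∈ (∅ : Set M))
          · exact (hd.subset ⟨h2, hOu ⟨h3, h2⟩, h1⟩ : x ∈ (∅ : Set M))
        · intro h
          have h2 : x ∈ Zᶜ := fun hz => h (Or.inr (hZO hz))
          refine ⟨?_, h2⟩
          rcases huv h2 with h3 | h3
          · exact absurd (Or.inl ⟨h3, h2⟩) h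
          · exact h3
      rw [this]
      exact ((hu.inter hZ.isOpen_compl).union hO).isClosed_compl
    rcases isClopen_iff.1 hcl with h | h
    · left
      intro x hx
      rcases huv hx with h3 | h3
      · exact h3
      · exact absurd (h.subset ⟨h3, hx⟩) (notMem_empty x)
    · right
      intro x _
      exact (h.symm.subset (mem_univ x)).1
  rw [isPreconnected_iff_subset_of_disjoint]
  intro u v hu hv huv hd
  have hsub : O \ Z ⊆ Zᶜ := fun x hx => hx.2
  rcases isPreconnected_iff_subset_of_disjoint.1 hOZ u v hu hv (hsub.trans huv)
    (subset_eq_empty (inter_subset_inter_left _ hsub) hd) with h | h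
  · exact key u v hu hv huv hd h
  · exact (key v u hv hu (by rwa [union_comm]) (by rwa [inter_comm v u]) h).symm

theorem image_component {S M : Type*} [TopologicalSpace S] [CompactSpace S]
    [LocallyConnectedSpace S] [TopologicalSpace M] [T2Space M] {f : S → M} (hf : Continuous f)
    (ho : IsOpenMap f) {Z : Set M} (hZ : IsClosed Z) (hZc : IsPreconnected Zᶜ) {a : S}
    (ha : a ∉ f ⁻¹' Z) : Zᶜ ⊆ f '' connectedComponentIn (f ⁻¹' Z)ᶜ a := by
  have hK : IsOpen (f ⁻¹' Z)ᶜ := (hZ.preimage hf).isOpen_compl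
  set U := connectedComponentIn (f ⁻¹' Z)ᶜ a with hU
  have haU : a ∈ U := mem_connectedComponentIn ha
  refine hZc.subset_of_closure_inter_subset (ho _ hK.connectedComponentIn) ⟨f a, ha, a, haU, rfl⟩ ?_
  rintro y ⟨hy, hyZ⟩
  have : closure (f '' U) ⊆ f '' closure U :=
    closure_minimal (image_mono subset_closure) (isClosed_closure.isCompact.image hf).isClosed
  obtain ⟨x, hx, rfl⟩ := this hy
  refine ⟨x, ?_, rfl⟩
  have h1 : IsPreconnected (closure U ∩ (f ⁻¹' Z)ᶜ) :=
    isPreconnected_connectedComponentIn.subset_closure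
      (subset_inter subset_closure (connectedComponentIn_subset _ _)) inter_subset_left
  exact h1.subset_connectedComponentIn ⟨subset_closure haU, ha⟩ inter_subset_right ⟨hx, hyZ⟩

theorem exists_W {S M : Type*} [TopologicalSpace S] [CompactSpace S]
    [LocallyConnectedSpace S] [TopologicalSpace M] [T2Space M] {f : S → M} (hf : Continuous f)
    (ho : IsOpenMap f) {V : Set M} (hV : IsClosed V) {q : M} (hq : q ∉ V) :
    ∃ W : Set S, W.Finite ∧ Disjoint W (f ⁻¹' V) ∧ ∀ Z ⊆ V, IsClosed Z → IsPreconnected Zᶜ →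
      ∀ a ∉ f ⁻¹' Z, ∃ w ∈ W, w ∈ connectedComponentIn (f ⁻¹' Z)ᶜ a := by
  have hS0 : IsOpen (f ⁻¹' V)ᶜ := (hV.preimage hf).isOpen_compl
  have hsub : f ⁻¹' {q} ⊆ (f ⁻¹' V)ᶜ := by
    intro x hx hxV
    rw [mem_preimage, mem_singleton_iff] at hx
    exact hq (hx ▸ hxV)
  obtain ⟨W, hW1, hW2⟩ := (isClosed_singleton.preimage hf).isCompact.elim_nhds_subcover
    (fun p => connectedComponentIn (f ⁻¹' V)ᶜ p) (fun z (hz : z ∈ f ⁻¹' {q}) =>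
      hS0.connectedComponentIn.mem_nhds (mem_connectedComponentIn (hsub hz)))
  refine ⟨W, W.finite_toSet, Set.disjoint_left.2 fun w hw => hsub (hW1 w hw), ?_⟩
  intro Z hZV hZ hZc a ha
  obtain ⟨x, hx, hxq⟩ := image_component hf ho hZ hZc ha (fun h => hq (hZV h))
  obtain ⟨w, hw, hxw⟩ := mem_iUnion₂.1 (hW2 (show x ∈ f ⁻¹' {q} from hxq))
  refine ⟨w, hw, ?_⟩
  rw [connectedComponentIn_eq hx]
  refine isPreconnected_connectedComponentIn.subset_connectedComponentIn hxw
    ((connectedComponentIn_subset _ _).trans (compl_subset_compl.2 (preimage_mono hZV))) ?_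
  exact mem_connectedComponentIn (hsub (hW1 w hw))

theorem no_log {S M : Type*} [TopologicalSpace S] [CompactSpace S]
    [TopologicalSpace M] {f : S → M} (hf : Continuous f)
    (ho : IsOpenMap f) (hs : Function.Surjective f) {γ : ℝ → M} (hγ : Continuous γ)
    (hγc : IsClosed (range γ)) {φ : M → ℂ} (hφ : ∀ t : ℝ, φ (γ t) = Complex.exp (t * Complex.I))
    {L : S → ℂ} (hL : ContinuousOn L (f ⁻¹' range γ)) {c : ℤ} (hc : c ≠ 0)
    (hexp : ∀ x ∈ f ⁻¹' range γ, Complex.exp (L x) = φ (f x) ^ c) : False := by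
  have hK : IsCompact (f ⁻¹' range γ) := (hγc.preimage hf).isCompact
  have hne : (f ⁻¹' range γ).Nonempty := by
    obtain ⟨x, hx⟩ := hs (γ 0)
    exact ⟨x, 0, hx.symm⟩
  have him : ContinuousOn (fun x => (L x).im) (f ⁻¹' range γ) :=
    Complex.continuous_im.comp_continuousOn hL
  obtain ⟨x, hx, hmax⟩ := hK.exists_isMaxOn hne him
  obtain ⟨t, ht⟩ := hx
  have hcR : (c : ℝ) ≠ 0 := by exact_mod_cast hc
  obtain ⟨N, hNo, hxN, hN⟩ : ∃ N : Set S, IsOpen N ∧ x ∈ N ∧ ∀ y ∈ N, y ∈ f ⁻¹' range γ →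
      |(L y).im - (L x).im| < Real.pi := by
    have := Metric.continuousWithinAt_iff'.1 (him x ⟨t, ht⟩) Real.pi Real.pi_pos
    obtain ⟨N, hN, h1, h2⟩ := mem_nhdsWithin.1 this
    exact ⟨N, hN, h1, fun y hy hyK => h2 ⟨hy, hyK⟩⟩
  have hev : ∀ᶠ δ : ℝ in 𝓝 0, γ (t + δ / c) ∈ f '' N := by
    have hcont : Continuous (fun δ : ℝ => γ (t + δ / c)) := by fun_prop
    refine hcont.continuousAt.eventually_mem ((ho N hNo).mem_nhds ?_)
    exact ⟨x, hxN, by simp [ht]⟩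
  obtain ⟨δ, hδ, hδ0, hδπ⟩ : ∃ δ : ℝ, γ (t + δ / c) ∈ f '' N ∧ 0 < δ ∧ δ < Real.pi := by
    have h1 : ∀ᶠ δ : ℝ in 𝓝[>] 0, γ (t + δ / c) ∈ f '' N := hev.filter_mono nhdsWithin_le_nhds
    have h2 : ∀ᶠ δ : ℝ in 𝓝[>] 0, δ ∈ Ioo 0 Real.pi := Ioo_mem_nhdsGT Real.pi_pos
    obtain ⟨δ, h3, h4⟩ := (h1.and h2).exists
    exact ⟨δ, h3, h4.1, h4.2⟩
  obtain ⟨y, hyN, hy⟩ := hδ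
  have hyK : y ∈ f ⁻¹' range γ := ⟨_, hy.symm⟩
  have h1 := hexp x ⟨t, ht⟩
  have h2 := hexp y hyK
  rw [← ht, hφ, ← Complex.exp_int_mul] at h1
  rw [hy, hφ, ← Complex.exp_int_mul] at h2
  have h3 : Complex.exp (L y) = Complex.exp (L x + δ * Complex.I) := by
    rw [Complex.exp_add, h1, h2, ← Complex.exp_add]
    congr 1
    have : (c : ℂ) ≠ 0 := by exact_mod_cast hc
    push_cast
    field_simp
  obtain ⟨n, hn⟩ := Complex.exp_eq_exp_iff_exists_int.1 h3
  have h4 := congrArg Complex.im hn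
  simp at h4
  have h5 := hN y hyN hyK
  have h6 : (L y).im ≤ (L x).im := hmax hyK
  rw [h4, abs_lt] at h5
  have hπ := Real.pi_pos
  have hn1 : n < 1 := by
    have : (n : ℝ) < 1 := by nlinarith
    exact_mod_cast this
  have hn2 : -1 < n := by
    have : (-1 : ℝ) < n := by nlinarith
    exact_mod_cast this
  have hn0 : n = 0 := by omega
  subst hn0
  simp at h4
  linarith

end geom

section final

/-- The circles used in the argument. -/
noncomputable def circ {k : ℕ} (c : EuclideanSpace ℝ (Fin (k + 3))) (ρ : ℝ) (i : ℕ) (t : ℝ) :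
    EuclideanSpace ℝ (Fin (k + 3)) :=
  c + ((ρ * Real.cos t) • EuclideanSpace.single 0 (1 : ℝ) +
    (ρ * Real.sin t) • EuclideanSpace.single 1 (1 : ℝ) +
    (ρ / (i + 1)) • EuclideanSpace.single 2 (1 : ℝ))

theorem circ_zero {k : ℕ} (c : EuclideanSpace ℝ (Fin (k + 3))) (ρ : ℝ) (i : ℕ) (t : ℝ) :
    circ c ρ i t 0 = c 0 + ρ * Real.cos t := by
  have h1 : (0 : Fin (k + 3)) ≠ 1 := by simp [Fin.ext_iff]
  have h2 : (0 : Fin (k + 3)) ≠ 2 := by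
    rw [Ne, Fin.ext_iff]
    simp [Nat.mod_eq_of_lt (show 2 < k + 3 by omega)]
  simp [circ, h1, h2]

theorem circ_one {k : ℕ} (c : EuclideanSpace ℝ (Fin (k + 3))) (ρ : ℝ) (i : ℕ) (t : ℝ) :
    circ c ρ i t 1 = c 1 + ρ * Real.sin t := by
  have h1 : (1 : Fin (k + 3)) ≠ 0 := by simp [Fin.ext_iff]
  have h2 : (1 : Fin (k + 3)) ≠ 2 := by
    rw [Ne, Fin.ext_iff]
    simp [Nat.mod_eq_of_lt (show 2 < k + 3 by omega)]
  simp [circ, h1, h2]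

theorem circ_two {k : ℕ} (c : EuclideanSpace ℝ (Fin (k + 3))) (ρ : ℝ) (i : ℕ) (t : ℝ) :
    circ c ρ i t 2 = c 2 + ρ / (i + 1) := by
  have h1 : (2 : Fin (k + 3)) ≠ 0 := by
    rw [Ne, Fin.ext_iff]
    simp [Nat.mod_eq_of_lt (show 2 < k + 3 by omega)]
  have h2 : (2 : Fin (k + 3)) ≠ 1 := by
    rw [Ne, Fin.ext_iff]
    simp [Nat.mod_eq_of_lt (show 2 < k + 3 by omega)]
  simp [circ, h1, h2]

theorem circ_contDiff {k : ℕ} (c : EuclideanSpace ℝ (Fin (k + 3))) (ρ : ℝ) (i : ℕ) :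
    ContDiff ℝ 1 (circ c ρ i) := by
  unfold circ
  have h1 : ContDiff ℝ 1 Real.cos := Real.contDiff_cos
  have h2 : ContDiff ℝ 1 Real.sin := Real.contDiff_sin
  fun_prop

theorem circ_mem {k : ℕ} (c : EuclideanSpace ℝ (Fin (k + 3))) {ρ : ℝ} (hρ : 0 < ρ) (i : ℕ)
    (t : ℝ) : circ c ρ i t ∈ closedBall c (3 * ρ) := by
  rw [mem_closedBall, dist_eq_norm, circ, add_sub_cancel_left]
  have h3 : ρ / (i + 1) ≤ ρ := div_le_self hρ.le (by simp)
  have h3' : 0 ≤ ρ / (i + 1) := by positivity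
  have h1 := Real.abs_cos_le_one t
  have h2 := Real.abs_sin_le_one t
  refine (norm_add₃_le).trans ?_
  simp only [norm_smul, EuclideanSpace.norm_single, norm_one, mul_one, Real.norm_eq_abs, abs_mul,
    abs_of_pos hρ, abs_of_nonneg h3']
  nlinarith

theorem circ_range {k : ℕ} (c : EuclideanSpace ℝ (Fin (k + 3))) (ρ : ℝ) (i : ℕ) :
    IsCompact (range (circ c ρ i)) := by
  have hp : Function.Periodic (circ c ρ i) (2 * Real.pi) := by
    intro t; simp [circ]
  rw [← hp.image_Icc Real.two_pi_pos 0]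
  exact isCompact_Icc.image (circ_contDiff c ρ i).continuous

theorem circ_disj {k : ℕ} (c : EuclideanSpace ℝ (Fin (k + 3))) {ρ : ℝ} (hρ : 0 < ρ) {i j : ℕ}
    {s t : ℝ} (h : circ c ρ i s = circ c ρ j t) : i = j := by
  have h2 := congrArg (fun v : EuclideanSpace ℝ (Fin (k + 3)) => v 2) h
  simp only [circ_two, add_right_inj] at h2
  have hi : (0 : ℝ) < i + 1 := by positivity
  have hj : (0 : ℝ) < j + 1 := by positivity
  rw [div_eq_div_iff hi.ne' hj.ne'] at h2
  have := mul_left_cancel₀ hρ.ne' h2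
  have h3 : (i : ℝ) = j := by linarith
  exact_mod_cast h3

/-- Angular coordinate around the axis of the circles. -/
noncomputable def ang {k : ℕ} (c : EuclideanSpace ℝ (Fin (k + 3))) (ρ : ℝ)
    (v : EuclideanSpace ℝ (Fin (k + 3))) : ℂ :=
  (((v 0 - c 0) / ρ : ℝ) : ℂ) + (((v 1 - c 1) / ρ : ℝ) : ℂ) * Complex.I

theorem ang_continuous {k : ℕ} (c : EuclideanSpace ℝ (Fin (k + 3))) (ρ : ℝ) :
    Continuous (ang c ρ) := by
  unfold ang
  fun_prop

theorem ang_circ {k : ℕ} (c : EuclideanSpace ℝ (Fin (k + 3))) {ρ : ℝ} (hρ : 0 < ρ) (i : ℕ)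
    (t : ℝ) : ang c ρ (circ c ρ i t) = Complex.exp (t * Complex.I) := by
  rw [ang, circ_zero, circ_one, add_sub_cancel_left, add_sub_cancel_left,
    mul_div_cancel_left₀ _ hρ.ne', mul_div_cancel_left₀ _ hρ.ne', Complex.exp_mul_I,
    Complex.ofReal_cos, Complex.ofReal_sin]

theorem main {S M : Type*} [TopologicalSpace S] [T2Space S] [CompactSpace S] [ConnectedSpace S]
    [LocallyConnectedSpace S]
    (hch : ∀ x : S, ∃ e : OpenPartialHomeomorph S ℂ, x ∈ e.source)
    [TopologicalSpace M] [T2Space M] {k : ℕ}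
    {f : S → M} (hf : Continuous f) (ho : IsOpenMap f) (hs : Function.Surjective f)
    (y : M) (e : OpenPartialHomeomorph M (EuclideanSpace ℝ (Fin (k + 3)))) (hy : y ∈ e.source) :
    False := by
  classical
  have : ConnectedSpace M := hs.connectedSpace hf
  set c := e y with hc
  obtain ⟨R, hR0, hR⟩ : ∃ R > 0, ball c R ⊆ e.target :=
    Metric.isOpen_iff.1 e.open_target c (e.map_source hy)
  set ρ := R / 10 with hρdef
  have hρ : 0 < ρ := by positivity
  have hcb : closedBall c (3 * ρ) ⊆ ball c R := closedBall_subset_ball (by rw [hρdef]; linarith)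
  have hct : closedBall c (3 * ρ) ⊆ e.target := hcb.trans hR
  set V : Set M := e.symm '' closedBall c (3 * ρ) with hVdef
  have hV : IsClosed V :=
    ((isCompact_closedBall c (3 * ρ)).image_of_continuousOn (e.continuousOn_symm.mono hct)).isClosed
  obtain ⟨q, hq⟩ : ∃ q, q ∉ V := by
    let p : EuclideanSpace ℝ (Fin (k + 3)) := c + (5 * ρ) • EuclideanSpace.single 0 (1 : ℝ)
    have hpd : dist p c = 5 * ρ := by
      rw [dist_eq_norm, add_sub_cancel_left, norm_smul, EuclideanSpace.norm_single, norm_one,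
        mul_one, Real.norm_of_nonneg (by positivity)]
    have hpB : p ∈ ball c R := by rw [mem_ball, hpd, hρdef]; linarith
    refine ⟨e.symm p, ?_⟩
    rintro ⟨p', hp', h⟩
    have : p' = p := e.symm.injOn (hct hp') (hR hpB) h
    rw [this, mem_closedBall, hpd] at hp'
    linarith
  obtain ⟨W, hWf, hWd, hW⟩ := exists_W hf ho hV hq
  have hS0 : IsClosed (f ⁻¹' V) := hV.preimage hf
  obtain ⟨N, hN⟩ := rank_lemma hch hS0 hWf.isClosed.isOpen_compl
    (fun x hx hxW => Set.disjoint_left.1 hWd hxW hx)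
  let γ : Fin N → ℝ → M := fun i t => e.symm (circ c ρ i t)
  have hγc : ∀ i, Continuous (γ i) := fun i =>
    e.continuousOn_symm.comp_continuous (circ_contDiff c ρ i).continuous
      (fun t => hct (circ_mem c hρ i t))
  have hγr : ∀ i, range (γ i) = e.symm '' range (circ c ρ i) := fun i => by
    rw [← range_comp]; rfl
  have hγk : ∀ i, IsClosed (range (γ i)) := fun i => by
    rw [hγr]
    refine ((circ_range c ρ i).image_of_continuousOn (e.continuousOn_symm.mono ?_)).isClosed
    rintro _ ⟨t, rfl⟩
    exact hct (circ_mem c hρ i t)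
  have hγV : ∀ i, range (γ i) ⊆ V := by
    rintro i _ ⟨t, rfl⟩
    exact ⟨_, circ_mem c hρ i t, rfl⟩
  have heγ : ∀ i t, e (γ i t) = circ c ρ i t := fun i t => e.right_inv (hct (circ_mem c hρ i t))
  set Z : Set M := ⋃ i, range (γ i) with hZdef
  have hZV : Z ⊆ V := iUnion_subset hγV
  have hZ : IsClosed Z := isClosed_iUnion_of_finite hγk
  have hZc : IsPreconnected Zᶜ := by
    refine compl_preconnected (O := e.symm '' ball c R) hZ
      (e.symm.isOpen_image_of_subset_source isOpen_ball hR) (hZV.trans (image_mono hcb)) ?_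
    have h1 := ball_diff_preconnected (by simp) (fun i : Fin N => circ c ρ i)
      (fun i => circ_contDiff c ρ i) c R
    have h2 := h1.image e.symm (e.continuousOn_symm.mono (fun x hx => hR hx.1))
    convert h2 using 1
    ext z
    constructor
    · rintro ⟨⟨p, hp, rfl⟩, hz⟩
      refine ⟨p, ⟨hp, ?_⟩, rfl⟩
      intro hpz
      obtain ⟨i, t, rfl⟩ := mem_iUnion.1 hpz
      exact hz (mem_iUnion.2 ⟨i, t, rfl⟩)
    · rintro ⟨p, ⟨hp, hpz⟩, rfl⟩
      refine ⟨⟨p, hp, rfl⟩, ?_⟩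
      intro hz
      obtain ⟨i, t, ht⟩ := mem_iUnion.1 hz
      have : circ c ρ i t = p := e.symm.injOn (hct (circ_mem c hρ i t)) (hR hp) ht
      exact hpz (mem_iUnion.2 ⟨i, t, this⟩)
  let φ : M → ℂ := fun z => ang c ρ (e z)
  have hφ : ∀ i t, φ (γ i t) = Complex.exp (t * Complex.I) := fun i t => by
    simp only [φ, heγ, ang_circ c hρ]
  have hdisj : ∀ i j, i ≠ j → ∀ z ∈ range (γ i), z ∉ range (γ j) := by
    rintro i j hij _ ⟨s, rfl⟩ ⟨t, ht⟩
    have := congrArg e ht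
    rw [heγ, heγ] at this
    exact hij (Fin.ext (circ_disj c hρ this)).symm
  let g : Fin N → S → ℂ := fun i x => if f x ∈ range (γ i) then φ (f x) else 1
  have hg : ∀ i, ContinuousOn (g i) (f ⁻¹' Z) := by
    intro i
    have : f ⁻¹' Z = ⋃ j, f ⁻¹' range (γ j) := by rw [hZdef, preimage_iUnion]
    rw [this]
    refine (locallyFinite_of_finite _).continuousOn_iUnion (fun j => (hγk j).preimage hf) ?_
    intro j
    by_cases hij : i = j
    · subst hij
      refine ContinuousOn.congr (f := fun x => φ (f x)) ?_ (fun x hx => if_pos hx)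
      refine (ang_continuous c ρ).comp_continuousOn (e.continuousOn.comp hf.continuousOn ?_)
      rintro x ⟨t, ht⟩
      rw [← ht]
      exact e.map_target (hct (circ_mem c hρ i t))
    · refine ContinuousOn.congr (f := fun x => 1) continuousOn_const (fun x hx => if_neg ?_)
      exact hdisj j i (Ne.symm hij) _ hx
  have hg0 : ∀ i, ∀ x ∈ f ⁻¹' Z, g i x ≠ 0 := by
    intro i x _
    simp only [g]
    split_ifs with h
    · obtain ⟨t, ht⟩ := h
      rw [← ht, hφ]
      exact Complex.exp_ne_zero _
    · exact one_ne_zero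
  have hH : ∀ i, ∃ H : S → ℂ, Continuous H ∧ EqOn H (g i) (f ⁻¹' Z) ∧ {x | H x = 0} ⊆ W :=
    fun i => push hch (hZ.preimage hf) hWf (hW Z hZV hZ hZc) (hg i) (hg0 i)
  choose H hHc hHg hH0 using hH
  obtain ⟨a, ha0, L, hL, hexp⟩ := hN H hHc (fun i x hx h => hx (hH0 i h))
  obtain ⟨i, hi⟩ := Function.ne_iff.1 ha0
  have hsub : f ⁻¹' range (γ i) ⊆ f ⁻¹' V := preimage_mono (hγV i)
  refine no_log hf ho hs (hγc i) (hγk i) (hφ i) (hL.mono hsub) hi ?_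
  intro x hx
  have hxZ : x ∈ f ⁻¹' Z := mem_iUnion.2 ⟨i, hx⟩
  rw [hexp x (hsub hx), Finset.prod_eq_single i]
  · rw [hHg i hxZ]
    simp only [g, if_pos (show f x ∈ range (γ i) from hx)]
  · intro j _ hji
    rw [hHg j hxZ]
    simp only [g, if_neg (hdisj i j (Ne.symm hji) _ hx), one_zpow]
  · simp

end final

end OSS

/-- If there is a continuous open surjection from a closed surface `S` (a compact connected
2-dimensional topological manifold without boundary) onto a topological manifold `M` of
dimension `m`, then `m ≤ 2`. -/
theorem dim_le_two_of_open_surjection_from_surface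
    (S : Type*) [TopologicalSpace S] [T2Space S] [SecondCountableTopology S]
    [CompactSpace S] [ConnectedSpace S]
    [ChartedSpace (EuclideanSpace ℝ (Fin 2)) S]
    (m : ℕ)
    (M : Type*) [TopologicalSpace M] [T2Space M] [SecondCountableTopology M]
    [ChartedSpace (EuclideanSpace ℝ (Fin m)) M]
    (f : S → M) (hcont : Continuous f) (hopen : IsOpenMap f)
    (hsurj : Function.Surjective f) :
    m ≤ 2 := by
  by_contra hm
  obtain ⟨k, rfl⟩ : ∃ k, m = k + 3 := ⟨m - 3, by omega⟩
  have : LocallyConnectedSpace S := ChartedSpace.locallyConnectedSpace (EuclideanSpace ℝ (Fin 2)) S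
  obtain ⟨x⟩ : Nonempty S := inferInstance
  refine OSS.main (k := k) (fun x => ?_) hcont hopen hsurj (f x)
    (chartAt (EuclideanSpace ℝ (Fin (k + 3))) (f x)) (mem_chart_source _ _)
  exact ⟨(chartAt (EuclideanSpace ℝ (Fin 2)) x).transHomeomorph
    Complex.orthonormalBasisOneI.repr.symm.toHomeomorph, mem_chart_source _ _⟩
end

section
/- Every compact subgroup of the group Homeo₊(S¹) of orientation-preserving homeomorphisms of the circle is conjugate within Homeo₊(S¹) to a subgroup of the rotation group SO(2, ℝ); in particular, up to conjugacy, SO(2, ℝ) is the unique maximal compact subgroup of Homeo₊(S¹). Consequently, every compact connected nontrivial subgroup of Homeo(S¹) has dimension 1. -/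
/-- The topology on the homeomorphism group of a space, induced from the compact-open
topology on `C(X, X)`; for the (compact metric) circle this is exactly the topology of
uniform convergence. -/
instance Homeomorph.instTopologicalSpaceSelf (X : Type*) [TopologicalSpace X] :
    TopologicalSpace (X ≃ₜ X) :=
  TopologicalSpace.induced (fun h => (⟨h, h.continuous⟩ : C(X, X))) inferInstance

/-- The circle `S¹ = ℝ/ℤ`. -/
abbrev Circle1 : Type := AddCircle (1 : ℝ)

/-- A self-homeomorphism of the circle is orientation preserving if it admits a strictly
increasing continuous lift `H : ℝ → ℝ` commuting with the unit translation. -/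
def OrientationPreserving (h : Circle1 ≃ₜ Circle1) : Prop :=
  ∃ H : ℝ → ℝ, Continuous H ∧ StrictMono H ∧ (∀ t : ℝ, H (t + 1) = H t + 1) ∧
    ∀ t : ℝ, h (t : Circle1) = ((H t : ℝ) : Circle1)

/-- A self-homeomorphism of the circle is a (rigid) rotation if it is translation by some
element; the rotations form the subgroup `SO(2, ℝ)` of `Homeo₊(S¹)`. -/
def IsRotation (h : Circle1 ≃ₜ Circle1) : Prop :=
  ∃ a : Circle1, ∀ x : Circle1, h x = a + x


namespace CircleHomeoAux

open MeasureTheory Topology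

/-- The embedding into continuous maps. -/
def toC (h : Circle1 ≃ₜ Circle1) : C(Circle1, Circle1) := ⟨h, h.continuous⟩

theorem isEmbedding_toC : IsEmbedding toC :=
  ⟨⟨rfl⟩, fun a b h => Homeomorph.ext fun x => DFunLike.congr_fun h x⟩

instance : T2Space (Circle1 ≃ₜ Circle1) := isEmbedding_toC.t2Space

instance : ContinuousMul (Circle1 ≃ₜ Circle1) where
  continuous_mul := by
    rw [isEmbedding_toC.continuous_iff]
    exact (isEmbedding_toC.continuous.comp continuous_fst).compCM
      (isEmbedding_toC.continuous.comp continuous_snd)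

theorem continuous_eval (x : Circle1) : Continuous fun h : Circle1 ≃ₜ Circle1 => h x :=
  (ContinuousEvalConst.continuous_eval_const (F := C(Circle1, Circle1)) x).comp isEmbedding_toC.continuous

theorem mul_apply' (a b : Circle1 ≃ₜ Circle1) (x : Circle1) : (a * b) x = a (b x) := rfl

theorem isTopologicalGroup_of_compact (G : Type*) [TopologicalSpace G] [Group G] [ContinuousMul G]
    [CompactSpace G] [T2Space G] : IsTopologicalGroup G where
  continuous_inv := by
    let e : G × G ≃ G × G :=
      { toFun := fun p => (p.1, p.1 * p.2)
        invFun := fun p => (p.1, p.1⁻¹ * p.2)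
        left_inv := fun p => by simp
        right_inv := fun p => by simp }
    have he : Continuous e := by
      change Continuous fun p : G × G => (p.1, p.1 * p.2)
      fun_prop
    have h2 : Continuous e.symm := he.continuous_symm_of_equiv_compact_to_t2
    have h3 : Continuous fun a : G => (e.symm (a, 1)).2 := by fun_prop
    have : (fun a : G => (e.symm (a, 1)).2) = fun a => a⁻¹ := by
      funext a
      change a⁻¹ * 1 = a⁻¹
      simp
    rwa [this] at h3

theorem coe_eq_iff (a b : ℝ) : (a : Circle1) = (b : Circle1) ↔ ∃ n : ℤ, a = b + n := by
  rw [← sub_eq_zero, ← AddCircle.coe_sub, AddCircle.coe_eq_zero_iff]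
  constructor
  · rintro ⟨n, hn⟩
    exact ⟨n, by simp at hn; linarith⟩
  · rintro ⟨n, hn⟩
    exact ⟨n, by simp [hn]⟩

/-- Lifts commute with integer translations. -/
theorem lift_add_int {H : ℝ → ℝ} (h1 : ∀ t, H (t + 1) = H t + 1) (t : ℝ) (n : ℤ) :
    H (t + n) = H t + n := by
  induction n using Int.induction_on with
  | zero => simp
  | succ k ih =>
    push_cast at ih ⊢
    rw [← add_assoc, h1, ih]; ring
  | pred k ih =>
    push_cast at ih ⊢
    have := h1 (t + (-(k : ℝ) - 1))
    rw [show t + (-(k : ℝ) - 1) + 1 = t + -(k : ℝ) by ring, ih] at this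
    linarith

/-- Normalised lift. -/
noncomputable def D (h : Circle1 ≃ₜ Circle1) (t : ℝ) : ℝ :=
  (AddCircle.equivIco 1 0 (h (t : Circle1) - h ((0 : ℝ) : Circle1)) : ℝ) + ⌊t⌋

theorem lift_eq_D {h : Circle1 ≃ₜ Circle1} {H : ℝ → ℝ} (hm : StrictMono H)
    (h1 : ∀ t, H (t + 1) = H t + 1) (hl : ∀ t : ℝ, h (t : Circle1) = ((H t : ℝ) : Circle1))
    (t : ℝ) : D h t = H t - H 0 := by
  have e : H t = H (Int.fract t) + ⌊t⌋ := by
    rw [← lift_add_int h1, Int.fract_add_floor]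
  have m1 : H 0 ≤ H (Int.fract t) := hm.monotone (Int.fract_nonneg t)
  have m2 : H (Int.fract t) < H 0 + 1 := by
    rw [← h1]; apply hm; simpa using Int.fract_lt_one t
  have key : h (t : Circle1) - h ((0 : ℝ) : Circle1) =
      ((H (Int.fract t) - H 0 : ℝ) : Circle1) := by
    rw [hl, hl, ← AddCircle.coe_sub, coe_eq_iff]
    exact ⟨⌊t⌋, by rw [e]; ring⟩
  unfold D
  rw [key, AddCircle.equivIco_coe_of_mem (y := H (Int.fract t) - H 0)
    ⟨by linarith, by linarith⟩, e]
  ring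

theorem measurable_D {K : Type*} [TopologicalSpace K] [MeasurableSpace K] [BorelSpace K]
    {f : K → Circle1 ≃ₜ Circle1} (hf : Continuous f) (t : ℝ) :
    Measurable fun k => D (f k) t := by
  unfold D
  refine Measurable.add_const ?_ _
  have h1 : Continuous fun k => f k (t : Circle1) - f k ((0 : ℝ) : Circle1) :=
    ((continuous_eval _).comp hf).sub ((continuous_eval _).comp hf)
  exact measurable_subtype_coe.comp
    ((AddCircle.measurableEquivIco 1 0).measurable.comp h1.measurable)

theorem D_sub_bound (h : Circle1 ≃ₜ Circle1) (t : ℝ) : ‖D h t - t‖ ≤ 1 := by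
  have h1 := (AddCircle.equivIco 1 0 (h (t : Circle1) - h ((0 : ℝ) : Circle1))).2
  have h2 := Int.floor_le t
  have h3 := Int.lt_floor_add_one t
  have h4 := h1.1
  have h5 := h1.2
  rw [Real.norm_eq_abs, abs_le]
  unfold D
  constructor <;> linarith

/-- A degree-one increasing map of the line induces a circle homeomorphism. -/
theorem exists_homeo {G : ℝ → ℝ} (hc : Continuous G) (hm : StrictMono G)
    (h1 : ∀ t, G (t + 1) = G t + 1) :
    ∃ g : Circle1 ≃ₜ Circle1, ∀ t : ℝ, g (t : Circle1) = ((G t : ℝ) : Circle1) := by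
  have hp : Function.Periodic (fun t : ℝ => ((G t : ℝ) : Circle1)) 1 := by
    intro t
    simp only [h1]
    exact (coe_eq_iff _ _).2 ⟨1, by simp⟩
  let f : Circle1 → Circle1 := hp.lift
  have hf : ∀ t : ℝ, f (t : Circle1) = ((G t : ℝ) : Circle1) := fun t => rfl
  have fc : Continuous f := by
    apply continuous_quot_lift
    exact (AddCircle.continuous_mk' 1).comp hc
  have finj : Function.Injective f := by
    intro x y
    induction x using QuotientAddGroup.induction_on with | _ s
    induction y using QuotientAddGroup.induction_on with | _ t
    intro h
    rw [hf, hf, coe_eq_iff] at h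
    obtain ⟨n, hn⟩ := h
    rw [← lift_add_int h1] at hn
    exact (coe_eq_iff _ _).2 ⟨n, hm.injective hn⟩
  have fsurj : Function.Surjective f := by
    intro y
    let z := AddCircle.equivIco 1 (G 0) y
    have hz : (z : ℝ) ∈ Set.Icc (G 0) (G 1) := by
      have := z.2
      have e := h1 0
      rw [zero_add] at e
      exact ⟨this.1, by rw [e]; exact this.2.le⟩
    obtain ⟨t, -, ht⟩ := intermediate_value_Icc (zero_le_one' ℝ) hc.continuousOn hz
    exact ⟨t, by rw [hf, ht]; exact AddCircle.coe_equivIco⟩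
  exact ⟨fc.homeoOfEquivCompactToT2 (f := Equiv.ofBijective f ⟨finj, fsurj⟩), hf⟩

theorem conj (K : Subgroup (Circle1 ≃ₜ Circle1))
    (hK : IsCompact (K : Set (Circle1 ≃ₜ Circle1))) (hO : ∀ k ∈ K, OrientationPreserving k) :
    ∃ g : Circle1 ≃ₜ Circle1, OrientationPreserving g ∧
        ∀ k ∈ K, IsRotation (g * k * g⁻¹) := by
  have : CompactSpace K := isCompact_iff_compactSpace.1 hK
  have : ContinuousMul K := ⟨Continuous.subtype_mk
    ((continuous_subtype_val.comp continuous_fst).mul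
      (continuous_subtype_val.comp continuous_snd)) _⟩
  have : IsTopologicalGroup K := isTopologicalGroup_of_compact K
  let : MeasurableSpace K := borel K
  have : BorelSpace K := ⟨rfl⟩
  let μ₀ : Measure K := Measure.haarMeasure ⊤
  have : IsProbabilityMeasure μ₀ := ⟨by
    have := Measure.haarMeasure_self (K₀ := (⊤ : TopologicalSpace.PositiveCompacts K))
    simpa using this⟩
  let μ : Measure K := μ₀.inv
  have : μ.IsMulRightInvariant := by infer_instance
  have : IsProbabilityMeasure μ := Measure.isProbabilityMeasure_map measurable_inv.aemeasurable
  choose! H Hc Hm H1 Hl using hO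
  have HD : ∀ k : K, ∀ t, D k t = H k t - H k 0 := fun k t =>
    lift_eq_D (Hm k k.2) (H1 k k.2) (Hl k k.2) t
  have meas : ∀ t, Measurable fun k : K => D k t := measurable_D continuous_subtype_val
  have ib : ∀ t, Integrable (fun k : K => D k t - t) μ := fun t =>
    Integrable.of_bound ((meas t).sub_const t).aestronglyMeasurable 1
      (Filter.Eventually.of_forall fun k => D_sub_bound _ _)
  have iD : ∀ t, Integrable (fun k : K => D k t) μ := fun t => by
    have h := (ib t).add (integrable_const t)
    refine h.congr (Filter.Eventually.of_forall fun k => ?_)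
    simp
  let G : ℝ → ℝ := fun t => ∫ k : K, D k t ∂μ
  have Gc : Continuous G := by
    have e : G = fun t => (∫ k : K, (D k t - t) ∂μ) + t := by
      funext t
      rw [integral_sub (iD t) (integrable_const t)]
      simp [G]
    rw [e]
    refine Continuous.add ?_ continuous_id
    refine continuous_of_dominated (bound := fun _ => 1)
      (fun t => ((meas t).sub_const t).aestronglyMeasurable)
      (fun t => Filter.Eventually.of_forall fun k => D_sub_bound _ _) (integrable_const _)
      (Filter.Eventually.of_forall fun k => ?_)
    simp only [HD]
    have := Hc k k.2
    fun_prop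
  have Gm : StrictMono G := by
    intro s t hst
    have hpos : ∀ k : K, 0 < D k t - D k s := fun k => by
      have := Hm k k.2 hst
      rw [HD, HD]; linarith
    have : 0 < ∫ k : K, (D k t - D k s) ∂μ := by
      rw [integral_pos_iff_support_of_nonneg (fun k => (hpos k).le) ((iD t).sub (iD s))]
      have : Function.support (fun k : K => D k t - D k s) = Set.univ := by
        ext k; simpa using (hpos k).ne'
      rw [this]; simp
    rw [integral_sub (iD t) (iD s)] at this
    change 0 < G t - G s at this
    linarith
  have G1 : ∀ t, G (t + 1) = G t + 1 := by
    intro t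
    have : ∀ k : K, D k (t + 1) = D k t + 1 := fun k => by
      rw [HD, HD, H1 k k.2]; ring
    simp only [G, this]
    rw [integral_add (iD t) (integrable_const _)]
    simp
  have Gj : ∀ (j : K) (t : ℝ), G (H j t) = G t + G (H j 0) := by
    intro j t
    have e : ∀ k : K, D (k * j : K) t = D k (H j t) - D k (H j 0) := fun k => by
      rw [lift_eq_D (h := ((k * j : K) : Circle1 ≃ₜ Circle1)) (H := fun t => H k (H j t))
        ((Hm k k.2).comp (Hm j j.2)) (fun t => by rw [H1 j j.2, H1 k k.2])
        (fun t => by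
          rw [Subgroup.coe_mul, mul_apply', Hl j j.2, Hl k k.2]), HD, HD]
      ring
    have e2 : G t = ∫ k : K, D (k * j : K) t ∂μ :=
      (integral_mul_right_eq_self (fun k : K => D k t) j).symm
    simp only [e] at e2
    rw [integral_sub (iD _) (iD _)] at e2
    change G t = G (H j t) - G (H j 0) at e2
    linarith
  obtain ⟨g, hg⟩ := exists_homeo Gc Gm G1
  refine ⟨g, ⟨G, Gc, Gm, G1, hg⟩, fun k hk => ⟨(G (H k 0) : ℝ), fun x => ?_⟩⟩
  obtain ⟨y, rfl⟩ := g.surjective x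
  induction y using QuotientAddGroup.induction_on with | _ t
  have : (g * k * g⁻¹) (g (t : Circle1)) = g (k (t : Circle1)) := by
    change g (k (g.symm (g (t : Circle1)))) = _
    rw [g.symm_apply_apply]
  change (g * k * g⁻¹) (g (t : Circle1)) = _ + g (t : Circle1)
  rw [this, Hl k hk, hg, hg, Gj ⟨k, hk⟩ t, ← AddCircle.coe_add, add_comm]

/-- The rotation by `a`. -/
def rot (a : Circle1) : Circle1 ≃ₜ Circle1 := Homeomorph.addLeft a

theorem rot_apply (a x : Circle1) : rot a x = a + x := rfl

theorem continuous_rot : Continuous rot := by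
  rw [isEmbedding_toC.continuous_iff]
  exact (ContinuousMap.curry ⟨fun p : Circle1 × Circle1 => p.1 + p.2, continuous_add⟩).continuous

/-- The subgroup of rotations. -/
def Rot : Subgroup (Circle1 ≃ₜ Circle1) where
  carrier := {h | IsRotation h}
  mul_mem' := by
    rintro a b ⟨s, hs⟩ ⟨t, ht⟩
    exact ⟨s + t, fun x => by rw [mul_apply', ht, hs, add_assoc]⟩
  one_mem' := ⟨0, fun x => by rw [zero_add]; rfl⟩
  inv_mem' := by
    rintro a ⟨s, hs⟩
    refine ⟨-s, fun x => ?_⟩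
    change a.symm x = _
    rw [Homeomorph.symm_apply_eq, hs]; simp

theorem isCompact_Rot : IsCompact (Rot : Set (Circle1 ≃ₜ Circle1)) := by
  have : (Rot : Set (Circle1 ≃ₜ Circle1)) = Set.range rot := by
    ext h
    constructor
    · rintro ⟨a, ha⟩
      exact ⟨a, Homeomorph.ext fun x => by rw [ha, rot_apply]⟩
    · rintro ⟨a, rfl⟩
      exact ⟨a, fun x => rfl⟩
  rw [this]
  exact isCompact_range continuous_rot

theorem op_of_rotation {h : Circle1 ≃ₜ Circle1} (hh : IsRotation h) : OrientationPreserving h := by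
  obtain ⟨a, ha⟩ := hh
  induction a using QuotientAddGroup.induction_on with | _ s
  exact ⟨fun t => s + t, by fun_prop, fun a b hab => by simpa using hab, fun t => by ring,
    fun t => by rw [ha]; rfl⟩

theorem op_of_near {h h' : Circle1 ≃ₜ Circle1} (hO : OrientationPreserving h)
    (hd : dist (toC h) (toC h') < 1 / 4) : OrientationPreserving h' := by
  obtain ⟨H, Hc, Hm, H1, Hl⟩ := hO
  let δ : ℝ → ℝ := fun t => (AddCircle.equivIco 1 (-1/2) (h' (t : Circle1) - h (t : Circle1)) : ℝ)
  have hne : ∀ x : Circle1, h' x - h x ≠ ((-1/2 : ℝ) : Circle1) := by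
    intro x hx
    have h1 : dist (h x) (h' x) < 1 / 4 :=
      (ContinuousMap.dist_apply_le_dist (f := toC h) (g := toC h') x).trans_lt hd
    rw [dist_comm, dist_eq_norm, hx,
      (AddCircle.norm_coe_eq_abs_iff 1 one_ne_zero).2 (by norm_num [abs_of_neg])] at h1
    norm_num [abs_of_neg] at h1
  have δc : Continuous δ := by
    rw [continuous_iff_continuousAt]
    intro t
    have c1 : Continuous fun t : ℝ => h' (t : Circle1) - h (t : Circle1) :=
      (h'.continuous.comp (AddCircle.continuous_mk' 1)).sub
        (h.continuous.comp (AddCircle.continuous_mk' 1))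
    exact continuousAt_subtype_val.comp
      (ContinuousAt.comp (f := fun t : ℝ => h' (t : Circle1) - h (t : Circle1))
        (AddCircle.continuousAt_equivIco 1 (-1/2) (hne t)) c1.continuousAt)
  have δ1 : ∀ t, δ (t + 1) = δ t := by
    intro t
    have : ((t + 1 : ℝ) : Circle1) = (t : Circle1) := (coe_eq_iff _ _).2 ⟨1, by simp⟩
    simp only [δ, this]
  have hl : ∀ t : ℝ, h' (t : Circle1) = ((H t + δ t : ℝ) : Circle1) := by
    intro t
    rw [AddCircle.coe_add, ← Hl]
    simp only [δ, AddCircle.coe_equivIco]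
    abel
  have h1 : ∀ t, H (t + 1) + δ (t + 1) = H t + δ t + 1 := by
    intro t; rw [δ1, H1]; ring
  have hc : Continuous fun t => H t + δ t := Hc.add δc
  have hi : Function.Injective fun t => H t + δ t := by
    intro s t hst
    simp only at hst
    have : h' (s : Circle1) = h' (t : Circle1) := by rw [hl, hl, hst]
    obtain ⟨n, hn⟩ := (coe_eq_iff _ _).1 (h'.injective this)
    have e := lift_add_int (H := fun t => H t + δ t) h1 t n
    simp only [← hn] at e
    have : (n : ℝ) = 0 := by linarith
    rw [hn, this, add_zero]
  refine ⟨fun t => H t + δ t, hc, ?_, h1, hl⟩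
  rcases hc.strictMono_of_inj hi with h | h
  · exact h
  · exfalso
    have := h (zero_lt_one' ℝ)
    have e := h1 0
    simp only [zero_add] at e this
    linarith

theorem isClopen_op : IsClopen {h : Circle1 ≃ₜ Circle1 | OrientationPreserving h} := by
  have nb : ∀ h : Circle1 ≃ₜ Circle1, {h' | dist (toC h) (toC h') < 1 / 4} ∈ 𝓝 h := by
    intro h
    apply IsOpen.mem_nhds
    · exact isOpen_lt (continuous_const.dist isEmbedding_toC.continuous) continuous_const
    · simp
  constructor
  · rw [← isOpen_compl_iff, isOpen_iff_mem_nhds]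
    intro h hh
    filter_upwards [nb h] with h' hd hO
    exact hh (op_of_near hO (by rw [dist_comm]; exact hd))
  · rw [isOpen_iff_mem_nhds]
    intro h hh
    filter_upwards [nb h] with h' hd
    exact op_of_near hh hd

theorem connected_case (K : Subgroup (Circle1 ≃ₜ Circle1))
    (hK : IsCompact (K : Set (Circle1 ≃ₜ Circle1)))
    (hc : IsConnected (K : Set (Circle1 ≃ₜ Circle1))) (hne : K ≠ ⊥) :
    Nonempty (K ≃ₜ Circle1) := by
  have hO : ∀ k ∈ K, OrientationPreserving k := by
    have := hc.isPreconnected.subset_isClopen isClopen_op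
      ⟨1, K.one_mem, op_of_rotation Rot.one_mem⟩
    exact fun k hk => this hk
  obtain ⟨g, -, hg⟩ := conj K hK hO
  have : CompactSpace K := isCompact_iff_compactSpace.1 hK
  have : ConnectedSpace K := isConnected_iff_connectedSpace.1 hc
  let φ : K → Circle1 := fun k => g (k.1 (g⁻¹ 0))
  have hφ : ∀ (k : K) (x : Circle1), g (k.1 (g⁻¹ x)) = φ k + x := by
    intro k x
    obtain ⟨a, ha⟩ := hg k k.2
    have h0 : φ k = a + 0 := ha 0
    rw [h0, add_zero]
    exact ha x
  have gi : ∀ x, g⁻¹ (g x) = x := fun x => g.symm_apply_apply x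
  have φc : Continuous φ := g.continuous.comp ((continuous_eval _).comp continuous_subtype_val)
  have φinj : Function.Injective φ := by
    intro k l h
    apply Subtype.ext
    refine Homeomorph.ext fun x => ?_
    have h1 := hφ k (g x)
    have h2 := hφ l (g x)
    rw [gi] at h1 h2
    exact g.injective (by rw [h1, h2, h])
  have φmul : ∀ k l, φ (k * l) = φ k + φ l := by
    intro k l
    rw [← hφ k (φ l)]
    change g (k.1 (l.1 (g⁻¹ 0))) = g (k.1 (g⁻¹ (g (l.1 (g⁻¹ 0)))))
    rw [gi]
  let Φ : Additive K →+ Circle1 := AddMonoidHom.mk' (fun k => φ k.toMul) (fun a b => φmul _ _)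
  have hr : (Φ.range : Set Circle1) = Set.range φ := rfl
  have hpre : IsPreconnected (Set.range φ) := isPreconnected_range φc
  have hnt : (Set.range φ).Nontrivial := by
    obtain ⟨k, hk1⟩ := Subgroup.ne_bot_iff_exists_ne_one.1 hne
    exact ⟨φ k, ⟨k, rfl⟩, φ 1, ⟨1, rfl⟩, fun h => hk1 (φinj h)⟩
  have hinf := hpre.infinite_of_nontrivial hnt
  have hd : Dense (Φ.range : Set Circle1) := by
    rw [AddCircle.dense_addSubgroup_iff_ne_zmultiples]
    intro a ha he
    rw [← hr, he] at hinf
    apply hinf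
    have : IsOfFinAddOrder a := addOrderOf_ne_zero_iff.1 ha
    exact this.finite_zmultiples
  have φsurj : Function.Surjective φ := by
    rw [← Set.range_eq_univ, ← (isCompact_range φc).isClosed.closure_eq, ← hr]
    exact hd.closure_eq
  exact ⟨φc.homeoOfEquivCompactToT2 (f := Equiv.ofBijective φ ⟨φinj, φsurj⟩)⟩

end CircleHomeoAux

/-- Every compact subgroup of `Homeo₊(S¹)` is conjugate, by an orientation-preserving
homeomorphism, to a subgroup of the rotation group `SO(2, ℝ)` (which is itself a compact
subgroup consisting of orientation-preserving homeomorphisms); thus, up to conjugacy,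
`SO(2, ℝ)` is the unique maximal compact subgroup of `Homeo₊(S¹)`.  Consequently every
compact connected nontrivial subgroup of `Homeo(S¹)` has dimension `1`: it is
homeomorphic to the circle. -/
theorem compact_subgroup_of_circle_homeos_conjugate_to_rotations :
    -- rotations form a compact subgroup of orientation-preserving homeomorphisms
    (∃ Rot : Subgroup (Circle1 ≃ₜ Circle1),
      (∀ h : Circle1 ≃ₜ Circle1, h ∈ Rot ↔ IsRotation h) ∧
      IsCompact (Rot : Set (Circle1 ≃ₜ Circle1)) ∧
      ∀ h ∈ Rot, OrientationPreserving h) ∧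
    -- every compact subgroup of `Homeo₊(S¹)` conjugates into the rotations
    (∀ K : Subgroup (Circle1 ≃ₜ Circle1),
      IsCompact (K : Set (Circle1 ≃ₜ Circle1)) →
      (∀ k ∈ K, OrientationPreserving k) →
      ∃ g : Circle1 ≃ₜ Circle1, OrientationPreserving g ∧
        ∀ k ∈ K, IsRotation (g * k * g⁻¹)) ∧
    -- every compact connected nontrivial subgroup of `Homeo(S¹)` has dimension 1
    -- (for compact connected groups, being one-dimensional is equivalent to being
    -- homeomorphic to the circle)
    (∀ K : Subgroup (Circle1 ≃ₜ Circle1),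
      IsCompact (K : Set (Circle1 ≃ₜ Circle1)) →
      IsConnected (K : Set (Circle1 ≃ₜ Circle1)) →
      K ≠ ⊥ →
      Nonempty (K ≃ₜ Circle1)) := by
  refine ⟨⟨CircleHomeoAux.Rot, fun h => Iff.rfl, CircleHomeoAux.isCompact_Rot,
    fun h hh => CircleHomeoAux.op_of_rotation hh⟩, CircleHomeoAux.conj,
    CircleHomeoAux.connected_case⟩
end
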